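/- Every (P2∪P4, bull, F1)-free simple graph G satisfies χ(G) ≤ ω(G)(ω(G)+1)/2, i.e., χ(G) ≤ C(ω(G)+1, 2). -/

import Mathlib

open SimpleGraph

/-- `H` is (isomorphic to) an induced subgraph of `G`. -/
def ContainsInduced {α β : Type*} (H : SimpleGraph α) (G : SimpleGraph β) : Prop :=
  ∃ f : α ↪ β, ∀ a b : α, G.Adj (f a) (f b) ↔ H.Adj a b

/-- The disjoint union `P2 ∪ P4`. -/
def P2UnionP4 : SimpleGraph (Fin 6) :=
  SimpleGraph.fromEdgeSet {s(0,1), s(2,3), s(3,4), s(4,5)}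

/-- The bull: a triangle with two disjoint pendant edges. -/
def BullGraph : SimpleGraph (Fin 5) :=
  SimpleGraph.fromEdgeSet {s(0,1), s(0,2), s(1,2), s(0,3), s(1,4)}

/-- The triangle `C3`. -/
def TriangleGraph : SimpleGraph (Fin 3) := ⊤

/-- The paw: a triangle with a pendant edge. -/
def PawGraph : SimpleGraph (Fin 4) :=
  SimpleGraph.fromEdgeSet {s(0,1), s(0,2), s(1,2), s(0,3)}

/-- The diamond: `K4` minus an edge. -/
def DiamondGraph : SimpleGraph (Fin 4) :=
  SimpleGraph.fromEdgeSet {s(0,1), s(0,2), s(0,3), s(1,2), s(1,3)}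

/-- The 5-cycle. -/
def Cycle5 : SimpleGraph (Fin 5) :=
  SimpleGraph.fromEdgeSet {s(0,1), s(1,2), s(2,3), s(3,4), s(0,4)}

/-- The 7-cycle. -/
def Cycle7 : SimpleGraph (Fin 7) :=
  SimpleGraph.fromEdgeSet {s(0,1), s(1,2), s(2,3), s(3,4), s(4,5), s(5,6), s(0,6)}

/-- The Grötzsch graph `F1`: vertex `0` is `v`, vertices `1,…,5` are `w1,…,w5`,
vertices `6,…,10` are `v1,…,v5`; `v` is adjacent exactly to the `wᵢ`, the `vᵢ` form a
5-cycle, and `wᵢ` is adjacent exactly to `v`, `vᵢ` and `vᵢ₊₂` (indices mod 5). -/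
def GrotzschGraph : SimpleGraph (Fin 11) :=
  SimpleGraph.fromEdgeSet
    {s(0,1), s(0,2), s(0,3), s(0,4), s(0,5),
     s(6,7), s(7,8), s(8,9), s(9,10), s(6,10),
     s(1,6), s(1,8), s(2,7), s(2,9), s(3,8), s(3,10), s(4,9), s(4,6), s(5,10), s(5,7)}

/-- The Clebsch graph `F2`: vertices are the elements of `(ℤ/2)⁴`, two vertices adjacent
iff their difference is one of `e1, e2, e3, e4, e1+e2+e3+e4`. -/
def ClebschGraph : SimpleGraph (Fin 4 → ZMod 2) :=
  SimpleGraph.fromRel (fun x y =>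
    x - y ∈ ({Pi.single 0 1, Pi.single 1 1, Pi.single 2 1, Pi.single 3 1, 1} :
      Set (Fin 4 → ZMod 2)))

/-- A graph is perfect if every induced subgraph has chromatic number equal to clique number. -/
def SimpleGraph.IsPerfect {V : Type*} (G : SimpleGraph V) : Prop :=
  ∀ S : Set V, (G.induce S).chromaticNumber = ((G.induce S).cliqueNum : ℕ∞)

/-- A graph is perfectly divisible if each nonempty induced subgraph `H` has a partition
`(A, B)` of its vertex set such that `H[A]` is perfect and `ω(H[B]) < ω(H)`. -/
def SimpleGraph.PerfectlyDivisible {V : Type*} (G : SimpleGraph V) : Prop :=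
  ∀ S : Set V, S.Nonempty → ∃ A B : Set V, A ∪ B = S ∧ A ∩ B = ∅ ∧
    (G.induce A).IsPerfect ∧ (G.induce B).cliqueNum < (G.induce S).cliqueNum

/-! ### Induced patterns

A pattern is a list of numbers: bit `i` of entry `j` records, for `i < j`, whether the vertices
`i` and `j` are adjacent. -/

namespace InducedSearch

/-- Adjacency of the vertices `a` and `b` of a pattern. -/
def adjAt (A : List ℕ) (a b : ℕ) : Bool :=
  if a < b then (A.getD b 0).testBit a
  else if b < a then (A.getD a 0).testBit b
  else false

/-- `m` is the set of neighbours of the vertex `i` of the pattern `A`. -/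
def isRow (A : List ℕ) (i m : ℕ) : Bool :=
  (List.range A.length).all fun j => m.testBit j == adjAt A i j

/-- The base `16` digits of `c` encode a pattern in `pats` followed by an embedding of it
into `A`. -/
def embeds (pats : List (List ℕ)) (A : List ℕ) (c : ℕ) : Bool :=
  match pats[c % 16]? with
  | none => false
  | some P => (List.range P.length).all fun j =>
      decide (c / 16 ^ (j + 1) % 16 < A.length) && (List.range j).all fun i =>
        adjAt A (c / 16 ^ (i + 1) % 16) (c / 16 ^ (j + 1) % 16) == (P.getD j 0).testBit i

/-- The possible neighbourhoods in a pattern `A` with `n + 1` vertices, given a list of the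
possible neighbourhoods in its first `n` vertices. -/
def refine (pats : List (List ℕ)) (A : List ℕ) (n : ℕ) : List ℕ → List ℕ → List ℕ
  | [], _ => []
  | l :: L, r =>
    (if embeds pats (A ++ [l]) (r.headD 0) then [] else [l]) ++
      (if embeds pats (A ++ [l ||| 2 ^ n]) (r.tail.headD 0) then [] else [l ||| 2 ^ n]) ++
        refine pats A n L r.tail.tail

/-- A colouring instruction: the vertices with neighbourhood `trace` get the colour `touching`
if they have a neighbour with neighbourhood `pivot`, and the colour `base` otherwise. -/
structure ColorEntry where
  trace : ℕ
  base : ℕ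
  touching : ℕ
  pivot : ℕ
  certs : List ℕ

/-- Two entries never give the same colour to adjacent vertices. -/
def ColorEntry.compatible (pats : List (List ℕ)) (A : List ℕ) (e e' : ColorEntry) (c : ℕ) : Bool :=
  (e.base != e'.base && e.base != e'.touching && e.touching != e'.base &&
      e.touching != e'.touching) ||
    embeds pats (A ++ [e.trace, e'.trace ||| 2 ^ A.length]) c ||
    (e'.base == e'.touching && (e'.trace == e.pivot || e.base != e'.base) &&
      (e.touching != e'.base || embeds pats
        (A ++ [e.trace, e.pivot ||| 2 ^ A.length, e'.trace ||| 2 ^ A.length]) c))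

/-- `e` is compatible with all members of a list. -/
def ColorEntry.compatibleAll (pats : List (List ℕ)) (A : List ℕ) (e : ColorEntry) :
    List ColorEntry → List ℕ → Bool
  | [], _ => true
  | e' :: es, r => e.compatible pats A e' (r.headD 0) && e.compatibleAll pats A es r.tail

/-- The entries of a list are pairwise compatible. -/
def ColorEntry.pairwise (pats : List (List ℕ)) (A : List ℕ) : List ColorEntry → Bool
  | [] => true
  | e :: es => e.compatibleAll pats A (e :: es) e.certs && ColorEntry.pairwise pats A es

/-- A folding instruction: the vertices with neighbourhood `trace` are mapped to `target`. -/
structure FoldEntry where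
  trace : ℕ
  target : ℕ
  certs : List ℕ
  certs' : List ℕ

/-- Neighbours of the vertices of the entry `e` that are moved as well. -/
def FoldEntry.movedOk (pats : List (List ℕ)) (A : List ℕ) (e : FoldEntry) :
    List FoldEntry → List ℕ → Bool
  | [], _ => true
  | f :: F, r => (adjAt A e.target f.target ||
      embeds pats (A ++ [e.trace, f.trace ||| 2 ^ A.length]) (r.headD 0)) &&
        e.movedOk pats A F r.tail

/-- Neighbours of the vertices of the entry `e` that are not moved. -/
def FoldEntry.fixedOk (pats : List (List ℕ)) (A : List ℕ) (e : FoldEntry) :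
    List ℕ → List ℕ → Bool
  | [], _ => true
  | l :: L, r => (l.testBit e.target ||
      embeds pats (A ++ [e.trace, l ||| 2 ^ A.length]) (r.headD 0)) && e.fixedOk pats A L r.tail

/-- The neighbourhoods that do not occur in a list of folding instructions. -/
def unmoved (F : List FoldEntry) (L : List ℕ) : List ℕ :=
  L.filter fun l => F.all fun e => e.trace != l

/-- A search tree that refutes the occurrence of a pattern. -/
inductive Refutation where
  | leaf (es : List ColorEntry)
  | gone (i : ℕ)
  | dominated (u v : ℕ)
  | fold (F : List FoldEntry) (t : Refutation)
  | branch (m : ℕ) (r : List ℕ) (t t' : Refutation)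

/-- Validity of a search tree for the pattern `A`, when `L` contains all neighbourhoods in it. -/
def Refutation.check (pats : List (List ℕ)) : Refutation → List ℕ → List ℕ → Bool
  | leaf es, A, L => (L.all fun l => es.any fun e => e.trace == l) &&
      (es.all fun e => decide (e.base < 3) && decide (e.touching < 3)) &&
        ColorEntry.pairwise pats A es
  | gone i, A, L => decide (i < A.length) && L.all fun l => !isRow A i l
  | dominated u v, A, L => decide (u < A.length) && decide (v < A.length) &&
      (List.range A.length).any (fun j => adjAt A u j != adjAt A v j) &&
        L.all fun l => !l.testBit u || l.testBit v
  | fold F t, A, L =>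
      (F.all fun e => decide (e.target < A.length) && (F.all fun f => !isRow A e.target f.trace) &&
        e.movedOk pats A F e.certs && e.fixedOk pats A (unmoved F L) e.certs') &&
          t.check pats A (unmoved F L)
  | branch m r t t', A, L =>
      t.check pats (A ++ [m]) (refine pats (A ++ [m]) A.length L r) &&
        t'.check pats A (L.filter fun l => l != m)

/-- All possible neighbourhoods in a pattern, computed one vertex at a time. -/
def traces (pats : List (List ℕ)) : List ℕ → List ℕ → List ℕ → List (List ℕ) → List ℕ
  | _, [], L, _ => L
  | B, m :: A, L, rs => traces pats (B ++ [m]) A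
      (refine pats (B ++ [m]) B.length L (rs.headD [])) rs.tail

variable {V : Type*} (G : SimpleGraph V)

/-- `φ` is an embedding of the pattern `A`. -/
def Realizes (A : List ℕ) (φ : ℕ → V) : Prop :=
  ∀ i j, i < j → j < A.length → (G.Adj (φ i) (φ j) ↔ (A.getD j 0).testBit i = true)

/-- `G` contains the pattern `A`. -/
def Occurs (A : List ℕ) : Prop := ∃ φ, Realizes G A φ

/-- `m` is the set of neighbours of `x` among the first `n` values of `φ`. -/
def IsTrace (φ : ℕ → V) (n : ℕ) (x : V) (m : ℕ) : Prop :=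
  ∀ i, m.testBit i = true ↔ i < n ∧ G.Adj x (φ i)

variable {G}

theorem Realizes.adj_iff {A : List ℕ} {φ : ℕ → V} (h : Realizes G A φ) {a b : ℕ}
    (ha : a < A.length) (hb : b < A.length) : G.Adj (φ a) (φ b) ↔ adjAt A a b = true := by
  unfold adjAt
  split_ifs with h1 h2
  · exact h a b h1 hb
  · rw [G.adj_comm]; exact h b a h2 ha
  · obtain rfl : a = b := by omega
    simp

theorem Realizes.embeds_eq_false {A : List ℕ} {φ : ℕ → V} (h : Realizes G A φ)
    {pats : List (List ℕ)} (hp : ∀ P ∈ pats, ¬ Occurs G P) (c : ℕ) :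
    embeds pats A c = false := by
  by_contra hc
  rw [Bool.not_eq_false] at hc
  unfold embeds at hc
  split at hc
  · simp at hc
  · rename_i P hP
    refine hp P (List.mem_of_getElem? hP) ⟨fun i => φ (c / 16 ^ (i + 1) % 16), fun i j hij hj => ?_⟩
    simp only [List.all_eq_true, List.mem_range, Bool.and_eq_true, decide_eq_true_eq,
      beq_iff_eq] at hc
    rw [← (hc j hj).2 i hij, h.adj_iff (hc i (hij.trans hj)).1 (hc j hj).1]

theorem Realizes.isRow {A : List ℕ} {φ : ℕ → V} (h : Realizes G A φ) {i m : ℕ}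
    (hi : i < A.length) (hm : IsTrace G φ A.length (φ i) m) : isRow A i m = true := by
  simp only [InducedSearch.isRow, List.all_eq_true, List.mem_range, beq_iff_eq]
  intro j hj
  rw [Bool.eq_iff_iff, hm j, ← h.adj_iff hi hj]
  simp [hj]

theorem Realizes.append {A : List ℕ} {φ : ℕ → V} (h : Realizes G A φ) {x : V} {m : ℕ}
    (hm : IsTrace G φ A.length x m) :
    Realizes G (A ++ [m]) (Function.update φ A.length x) := by
  intro i j hij hj
  rw [List.length_append, List.length_singleton] at hj
  rw [Function.update_of_ne (by omega : i ≠ A.length)]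
  rcases Nat.lt_succ_iff_lt_or_eq.1 hj with hj | rfl
  · rw [Function.update_of_ne hj.ne, h i j hij hj, List.getD_append _ _ _ _ hj]
  · rw [Function.update_self, List.getD_append_right _ _ _ _ le_rfl, G.adj_comm]
    simp [hm i, hij]

theorem IsTrace.update_of_adj {φ : ℕ → V} {n l : ℕ} {x y : V} (h : IsTrace G φ n y l)
    (hxy : G.Adj y x) : IsTrace G (Function.update φ n x) (n + 1) y (l ||| 2 ^ n) := by
  intro i
  rw [Nat.testBit_or, Nat.testBit_two_pow, Bool.or_eq_true, h i]
  rcases lt_trichotomy i n with hi | rfl | hi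
  · simp [Function.update_of_ne hi.ne, hi, hi.ne', hi.trans (Nat.lt_succ_self n)]
  · simp [hxy]
  · simp only [decide_eq_true_eq]
    constructor
    · rintro (⟨h, -⟩ | h) <;> omega
    · rintro ⟨h, -⟩; omega

theorem IsTrace.update_of_not_adj {φ : ℕ → V} {n l : ℕ} {x y : V} (h : IsTrace G φ n y l)
    (hxy : ¬ G.Adj y x) : IsTrace G (Function.update φ n x) (n + 1) y l := by
  intro i
  rw [h i]
  rcases lt_trichotomy i n with hi | rfl | hi
  · simp [Function.update_of_ne hi.ne, hi, hi.trans (Nat.lt_succ_self n)]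
  · simp [hxy]
  · constructor
    · rintro ⟨h, -⟩; omega
    · rintro ⟨h, -⟩; omega

theorem refine_complete {pats : List (List ℕ)} (hp : ∀ P ∈ pats, ¬ Occurs G P)
    {A : List ℕ} {φ : ℕ → V} {n : ℕ} (hA : Realizes G A φ) (hn : A.length = n + 1) {y : V} :
    ∀ {L : List ℕ} (r : List ℕ),
      (∃ l ∈ L, IsTrace G φ (n + 1) y l ∨ IsTrace G φ (n + 1) y (l ||| 2 ^ n)) →
        ∃ l ∈ refine pats A n L r, IsTrace G φ (n + 1) y l := by
  intro L
  rw [← hn]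
  induction L with
  | nil => simp
  | cons a L ih =>
    rintro r ⟨l, hl, h⟩
    rcases List.mem_cons.1 hl with rfl | hl
    · unfold refine
      rcases h with h | h
      · refine ⟨l, ?_, h⟩
        rw [(hA.append h).embeds_eq_false hp]
        simp
      · refine ⟨_, ?_, h⟩
        rw [(hA.append h).embeds_eq_false hp (r.tail.headD 0)]
        simp
    · obtain ⟨l, hl, h⟩ := ih r.tail.tail ⟨l, hl, h⟩
      exact ⟨l, by unfold refine; simp [hl], h⟩

theorem Realizes.embeds_pair_eq_false {A : List ℕ} {φ : ℕ → V} (h : Realizes G A φ)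
    {pats : List (List ℕ)} (hp : ∀ P ∈ pats, ¬ Occurs G P) {x y : V} {m l : ℕ}
    (hx : IsTrace G φ A.length x m) (hy : IsTrace G φ A.length y l) (hxy : G.Adj x y) (c : ℕ) :
    embeds pats (A ++ [m, l ||| 2 ^ A.length]) c = false := by
  have h2 := (h.append hx).append (m := l ||| 2 ^ A.length) (x := y)
    (by simpa using hy.update_of_adj hxy.symm)
  simpa using h2.embeds_eq_false hp c

theorem Realizes.embeds_path_eq_false {A : List ℕ} {φ : ℕ → V} (h : Realizes G A φ)
    {pats : List (List ℕ)} (hp : ∀ P ∈ pats, ¬ Occurs G P) {x w y : V} {m k l : ℕ}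
    (hx : IsTrace G φ A.length x m) (hw : IsTrace G φ A.length w k)
    (hy : IsTrace G φ A.length y l) (hxw : G.Adj x w) (hxy : G.Adj x y) (hyw : ¬ G.Adj y w)
    (c : ℕ) :
    embeds pats (A ++ [m, k ||| 2 ^ A.length, l ||| 2 ^ A.length]) c = false := by
  have h2 := (h.append hx).append (m := k ||| 2 ^ A.length) (x := w)
    (by simpa using hw.update_of_adj hxw.symm)
  have h3 := h2.append (m := l ||| 2 ^ A.length) (x := y)
    (by simpa using (hy.update_of_adj hxy.symm).update_of_not_adj hyw)
  simpa using h3.embeds_eq_false hp c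

theorem ColorEntry.exists_compatible_of_compatibleAll {pats : List (List ℕ)} {A : List ℕ}
    {e e' : ColorEntry} : ∀ {es : List ColorEntry} {r : List ℕ},
      e.compatibleAll pats A es r = true → e' ∈ es → ∃ c, e.compatible pats A e' c = true
  | [], _, _, he => by simp at he
  | f :: es, r, h, he => by
    rw [compatibleAll, Bool.and_eq_true] at h
    rcases List.mem_cons.1 he with rfl | he
    · exact ⟨_, h.1⟩
    · exact exists_compatible_of_compatibleAll h.2 he

theorem ColorEntry.exists_compatible_of_pairwise {pats : List (List ℕ)} {A : List ℕ}
    {e e' : ColorEntry} : ∀ {es : List ColorEntry}, ColorEntry.pairwise pats A es = true →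
      e ∈ es → e' ∈ es →
        ∃ c, e.compatible pats A e' c = true ∨ e'.compatible pats A e c = true
  | [], _, he, _ => by simp at he
  | f :: es, h, he, he' => by
    rw [pairwise, Bool.and_eq_true] at h
    rcases List.mem_cons.1 he with rfl | he1
    · exact (exists_compatible_of_compatibleAll h.1 he').imp fun _ => Or.inl
    rcases List.mem_cons.1 he' with rfl | he2
    · exact (exists_compatible_of_compatibleAll h.1 he).imp fun _ => Or.inr
    · exact exists_compatible_of_pairwise h.2 he1 he2

open Classical in
/-- The colour that the entry `e` gives to the vertex `x`. -/
noncomputable def ColorEntry.color (G : SimpleGraph V) (φ : ℕ → V) (n : ℕ) (e : ColorEntry)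
    (x : V) : ℕ :=
  if ∃ w, G.Adj x w ∧ IsTrace G φ n w e.pivot then e.touching else e.base

theorem Realizes.color_ne {A : List ℕ} {φ : ℕ → V} (h : Realizes G A φ)
    {pats : List (List ℕ)} (hp : ∀ P ∈ pats, ¬ Occurs G P)
    (hG : ∀ x y z, G.Adj x y → G.Adj x z → ¬ G.Adj y z) {e e' : ColorEntry} {c : ℕ}
    (hc : e.compatible pats A e' c = true) {x y : V} (hx : IsTrace G φ A.length x e.trace)
    (hy : IsTrace G φ A.length y e'.trace) (hxy : G.Adj x y) :
    e.color G φ A.length x ≠ e'.color G φ A.length y := by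
  simp only [ColorEntry.compatible, h.embeds_pair_eq_false hp hx hy hxy, Bool.or_false,
    Bool.or_eq_true, Bool.and_eq_true, bne_iff_ne, beq_iff_eq] at hc
  rcases hc with ⟨⟨⟨h1, h2⟩, h3⟩, h4⟩ | ⟨⟨h1, h2⟩, h3⟩
  · unfold ColorEntry.color
    split_ifs <;> assumption
  · have hy' : e'.color G φ A.length y = e'.base := by
      unfold ColorEntry.color
      split_ifs
      exacts [h1.symm, rfl]
    rw [hy']
    unfold ColorEntry.color
    split_ifs with hw
    · obtain ⟨w, hxw, hw⟩ := hw
      rw [h.embeds_path_eq_false hp hx hw hy hxw hxy (hG x y w hxy hxw)] at h3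
      simpa using h3
    · rcases h2 with h2 | h2
      · exact absurd ⟨y, hxy, h2 ▸ hy⟩ hw
      · exact h2

theorem FoldEntry.movedOk_cases {pats : List (List ℕ)} {A : List ℕ} {e f : FoldEntry} :
    ∀ {F : List FoldEntry} {r : List ℕ}, e.movedOk pats A F r = true → f ∈ F →
      adjAt A e.target f.target = true ∨
        ∃ c, embeds pats (A ++ [e.trace, f.trace ||| 2 ^ A.length]) c = true
  | [], _, _, he => by simp at he
  | g :: F, r, h, hf => by
    rw [movedOk, Bool.and_eq_true, Bool.or_eq_true] at h
    rcases List.mem_cons.1 hf with rfl | hf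
    · exact h.1.imp id fun h => ⟨_, h⟩
    · exact movedOk_cases h.2 hf

theorem FoldEntry.fixedOk_cases {pats : List (List ℕ)} {A : List ℕ} {e : FoldEntry} {l : ℕ} :
    ∀ {L r : List ℕ}, e.fixedOk pats A L r = true → l ∈ L →
      l.testBit e.target = true ∨
        ∃ c, embeds pats (A ++ [e.trace, l ||| 2 ^ A.length]) c = true
  | [], _, _, he => by simp at he
  | g :: F, r, h, hf => by
    rw [fixedOk, Bool.and_eq_true, Bool.or_eq_true] at h
    rcases List.mem_cons.1 hf with rfl | hf
    · exact h.1.imp id fun h => ⟨_, h⟩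
    · exact fixedOk_cases h.2 hf

theorem Realizes.not_isTrace_of_fold {A : List ℕ} {φ : ℕ → V} (h : Realizes G A φ)
    {pats : List (List ℕ)} (hp : ∀ P ∈ pats, ¬ Occurs G P)
    (hcrit : ∀ f : V → V, (∀ x y, G.Adj x y → G.Adj (f x) (f y)) → Function.Surjective f)
    {L : List ℕ} (hL : ∀ x, ∃ l ∈ L, IsTrace G φ A.length x l) {F : List FoldEntry}
    (hF : (F.all fun e => decide (e.target < A.length) &&
      (F.all fun f => !InducedSearch.isRow A e.target f.trace) &&
        e.movedOk pats A F e.certs && e.fixedOk pats A (unmoved F L) e.certs') = true)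
    (z : V) {e : FoldEntry} (he : e ∈ F) : ¬ IsTrace G φ A.length z e.trace := by
  classical
  intro hz
  simp only [List.all_eq_true, Bool.and_eq_true, decide_eq_true_eq, Bool.not_eq_true',
    and_assoc] at hF
  let P : V → Prop := fun x => ∃ e ∈ F, IsTrace G φ A.length x e.trace
  let f : V → V := fun x => if hx : P x then φ hx.choose.target else x
  have hfP : ∀ x, ¬ P (f x) := by
    intro x
    by_cases hx : P x
    · simp only [f, dif_pos hx]
      obtain ⟨he, -⟩ := hx.choose_spec
      obtain ⟨h1, h2, -⟩ := hF _ he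
      rintro ⟨e', he', ht⟩
      exact absurd (h.isRow h1 ht) (by simp [h2 e' he'])
    · simpa only [f, dif_neg hx] using hx
  have hmixed : ∀ x y (hx : P x), ¬ P y → G.Adj x y → G.Adj (f x) y := by
    intro x y hx hy hxy
    simp only [f, dif_pos hx]
    obtain ⟨he, ht⟩ := hx.choose_spec
    obtain ⟨h1, -, -, h4⟩ := hF _ he
    obtain ⟨l, hl, hyl⟩ := hL y
    have hlu : l ∈ unmoved F L := by
      simp only [unmoved, List.mem_filter, hl, true_and, List.all_eq_true, bne_iff_ne]
      rintro e' he' rfl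
      exact hy ⟨e', he', hyl⟩
    rcases FoldEntry.fixedOk_cases h4 hlu with h5 | ⟨c, h5⟩
    · exact ((hyl _).1 h5).2.symm
    · simp [h.embeds_pair_eq_false hp ht hyl hxy] at h5
  obtain ⟨w, hw⟩ := hcrit f (fun x y hxy => by
    by_cases hx : P x
    · by_cases hy : P y
      · simp only [f, dif_pos hx, dif_pos hy]
        obtain ⟨he, ht⟩ := hx.choose_spec
        obtain ⟨he', ht'⟩ := hy.choose_spec
        rcases FoldEntry.movedOk_cases (hF _ he).2.2.1 he' with h5 | ⟨c, h5⟩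
        · exact (h.adj_iff (hF _ he).1 (hF _ he').1).2 h5
        · simp [h.embeds_pair_eq_false hp ht ht' hxy] at h5
      · have : f y = y := dif_neg hy
        rw [this]
        exact hmixed x y hx hy hxy
    · have : f x = x := dif_neg hx
      rw [this]
      by_cases hy : P y
      · exact (hmixed y x hy hx hxy.symm).symm
      · have : f y = y := dif_neg hy
        rwa [this]) z
  exact hfP w (hw ▸ ⟨e, he, hz⟩)

theorem Refutation.sound {pats : List (List ℕ)} (hp : ∀ P ∈ pats, ¬ Occurs G P)
    (hG : ∀ x y z, G.Adj x y → G.Adj x z → ¬ G.Adj y z)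
    (hcrit : ∀ f : V → V, (∀ x y, G.Adj x y → G.Adj (f x) (f y)) → Function.Surjective f)
    (hcol : ¬ G.Colorable 3) : ∀ (t : Refutation) {A L : List ℕ} {φ : ℕ → V},
      t.check pats A L = true → Realizes G A φ → (∀ x, ∃ l ∈ L, IsTrace G φ A.length x l) → False
  | leaf es, A, L, φ, ht, hA, hL => by
    simp only [check, Bool.and_eq_true, List.all_eq_true, List.any_eq_true, beq_iff_eq,
      decide_eq_true_eq] at ht
    obtain ⟨⟨h1, h2⟩, h3⟩ := ht
    have hes : ∀ x, ∃ e ∈ es, IsTrace G φ A.length x e.trace := fun x => by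
      obtain ⟨l, hl, hx⟩ := hL x
      obtain ⟨e, he, rfl⟩ := h1 l hl
      exact ⟨e, he, hx⟩
    choose e he hx using hes
    refine hcol ⟨Coloring.mk (fun x => ⟨(e x).color G φ A.length x, ?_⟩) fun {x y} hxy => ?_⟩
    · unfold ColorEntry.color
      split_ifs
      exacts [(h2 _ (he x)).2, (h2 _ (he x)).1]
    · rw [Ne, Fin.mk.injEq]
      obtain ⟨c, hc | hc⟩ := ColorEntry.exists_compatible_of_pairwise h3 (he x) (he y)
      · exact hA.color_ne hp hG hc (hx x) (hx y) hxy
      · exact (hA.color_ne hp hG hc (hx y) (hx x) hxy.symm).symm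
  | gone i, A, L, φ, ht, hA, hL => by
    simp only [check, Bool.and_eq_true, List.all_eq_true, decide_eq_true_eq,
      Bool.not_eq_true'] at ht
    obtain ⟨l, hl, hx⟩ := hL (φ i)
    have := ht.2 l hl
    rw [hA.isRow ht.1 hx] at this
    cases this
  | dominated u v, A, L, φ, ht, hA, hL => by
    classical
    simp only [check, Bool.and_eq_true, List.all_eq_true, decide_eq_true_eq, List.any_eq_true,
      List.mem_range, bne_iff_ne, Bool.or_eq_true, Bool.not_eq_true'] at ht
    obtain ⟨⟨⟨hu, hv⟩, j, hj, hne⟩, hdom⟩ := ht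
    have huv : φ u ≠ φ v := fun h => hne <| by
      rw [Bool.eq_iff_iff, ← hA.adj_iff hu hj, ← hA.adj_iff hv hj, h]
    have hd : ∀ x, G.Adj x (φ u) → G.Adj x (φ v) := fun x hx => by
      obtain ⟨l, hl, hxl⟩ := hL x
      rcases hdom l hl with h | h
      · rw [(hxl u).2 ⟨hu, hx⟩] at h
        cases h
      · exact ((hxl v).1 h).2
    let f : V → V := fun x => if x = φ u then φ v else x
    obtain ⟨w, hw⟩ := hcrit f (fun x y hxy => by
      simp only [f]
      split_ifs with h1 h2 h2
      · exact absurd (h1.trans h2.symm) hxy.ne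
      · exact (hd y (h1 ▸ hxy.symm)).symm
      · exact hd x (h2 ▸ hxy)
      · exact hxy) (φ u)
    simp only [f] at hw
    split_ifs at hw with h1
    · exact huv hw.symm
    · exact h1 hw
  | fold F t, A, L, φ, ht, hA, hL => by
    rw [check, Bool.and_eq_true] at ht
    refine sound hp hG hcrit hcol t ht.2 hA fun x => ?_
    obtain ⟨l, hl, hx⟩ := hL x
    refine ⟨l, ?_, hx⟩
    simp only [unmoved, List.mem_filter, hl, true_and, List.all_eq_true, bne_iff_ne]
    rintro e he rfl
    exact hA.not_isTrace_of_fold hp hcrit hL ht.1 x he hx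
  | branch m r t t', A, L, φ, ht, hA, hL => by
    rw [check, Bool.and_eq_true] at ht
    by_cases hm : ∃ x, IsTrace G φ A.length x m
    · obtain ⟨x, hx⟩ := hm
      refine sound hp hG hcrit hcol t ht.1 (hA.append hx) fun y => ?_
      rw [List.length_append, List.length_singleton]
      refine refine_complete hp (hA.append hx) (by simp) r ?_
      obtain ⟨l, hl, hy⟩ := hL y
      by_cases hxy : G.Adj y x
      · exact ⟨l, hl, .inr (hy.update_of_adj hxy)⟩
      · exact ⟨l, hl, .inl (hy.update_of_not_adj hxy)⟩
    · refine sound hp hG hcrit hcol t' ht.2 hA fun x => ?_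
      obtain ⟨l, hl, hx⟩ := hL x
      refine ⟨l, ?_, hx⟩
      simp only [List.mem_filter, hl, true_and, bne_iff_ne]
      rintro rfl
      exact hm ⟨x, hx⟩

theorem exists_isTrace_traces {pats : List (List ℕ)} (hp : ∀ P ∈ pats, ¬ Occurs G P) :
    ∀ {A B L : List ℕ} {φ : ℕ → V} (rs : List (List ℕ)), Realizes G (B ++ A) φ →
      (∀ x, ∃ l ∈ L, IsTrace G φ B.length x l) →
        ∀ x, ∃ l ∈ traces pats B A L rs, IsTrace G φ (B ++ A).length x l
  | [], B, L, φ, _, _, hL => by simpa [traces] using hL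
  | m :: A, B, L, φ, rs, hA, hL => by
    have hA' : Realizes G ((B ++ [m]) ++ A) φ := by simpa using hA
    have hB : Realizes G (B ++ [m]) φ := fun i j hij hj => by
      rw [hA' i j hij (hj.trans_le (by simp)), List.getD_append _ _ _ _ hj]
    have := exists_isTrace_traces hp rs.tail hA' (L := refine pats (B ++ [m]) B.length L
        (rs.headD []))
      fun y => by
        rw [List.length_append, List.length_singleton]
        refine refine_complete hp hB (by simp) _ ?_
        obtain ⟨l, hl, hy⟩ := hL y
        have hφ : Function.update φ B.length (φ B.length) = φ := Function.update_eq_self _ _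
        by_cases hxy : G.Adj y (φ B.length)
        · exact ⟨l, hl, .inr (hφ ▸ hy.update_of_adj hxy)⟩
        · exact ⟨l, hl, .inl (hφ ▸ hy.update_of_not_adj hxy)⟩
    simpa [traces] using this

theorem not_occurs_of_check {pats : List (List ℕ)} (hp : ∀ P ∈ pats, ¬ Occurs G P)
    (hG : ∀ x y z, G.Adj x y → G.Adj x z → ¬ G.Adj y z)
    (hcrit : ∀ f : V → V, (∀ x y, G.Adj x y → G.Adj (f x) (f y)) → Function.Surjective f)
    (hcol : ¬ G.Colorable 3) (t : Refutation) {A : List ℕ} {rs : List (List ℕ)}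
    (ht : t.check pats A (traces pats [] A [0] rs) = true) : ¬ Occurs G A := by
  rintro ⟨φ, hφ⟩
  refine t.sound hp hG hcrit hcol ht hφ ?_
  exact exists_isTrace_traces hp rs (B := []) hφ fun x => ⟨0, by simp, fun i => by simp⟩

end InducedSearch

namespace InducedSearch

def linkedSpidersGraph : List ℕ := [0, 1, 0, 4, 0, 16, 21, 106]

def linkedSpidersRows : List (List ℕ) := [
  [],
  [0, 0, 0, 8448],
  [],
  [0, 0, 0, 17184, 0, 0, 0, 17184, 0, 0, 0, 17184],
  [0, 0, 0, 72556801, 0, 72495361, 0, 72418081, 0, 0, 0, 0, 0, 72356641],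
  [0, 0, 0, 25920, 0, 90382593, 0, 72753409, 0, 90243873, 56689985, 0, 0, 25920, 39912769, 0, 0,
    25920, 0, 72745761, 37094721, 0, 0, 25920, 52823361, 0, 0, 25920],
  [0, 0, 52823889, 0, 0, 30272, 88475441, 0, 0, 30240, 88483601, 0, 0, 0, 0, 30272, 0, 30240, 0,
    30240, 0, 30208, 0, 30208, 0, 30208, 0, 30208, 0, 30208],
  [0, 0, 0, 34656, 0, 34640, 57739329, 0, 0, 34608, 91293729, 0, 0, 34576, 0, 34576, 0, 34576, 0,
    34576, 0, 34576, 0, 34576, 91432961, 0, 0, 34608, 0, 34608, 0, 34640]]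

def linkedSpidersTree : Refutation :=
 .branch 22 [0, 58067329, 0, 0, 0, 0, 42010961, 0, 0, 38976, 75565361, 0, 0, 38944, 0, 38928,
   138807601, 38928, 0, 38928, 0, 38928, 0, 38928, 0, 38928, 88615169, 0, 123275297, 0, 0, 38976, 0,
   38944, 139003697, 38944, 0, 38944] (
  .fold [⟨0, 0, [57739921], [161962017, 52824721, 57739921, 162023217, 161825025, 161763585,
    161685761, 161624321, 161547041, 161839137, 136710801, 138807953, 161777457]⟩] <|
  .branch 297 [42535537, 0, 0, 43392, 60299873, 0, 0, 43392, 0, 43344, 37292609, 0, 0, 43312,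
    72944161, 0, 93530641, 0, 0, 43312, 0, 43312, 0, 43344, 123275809, 0, 0, 43264, 0, 43264, 0,
    43264, 0, 43264, 0, 43264] (
   .branch 26 [129567297, 163190305, 0, 146421249, 162933265, 179873573970018, 146147889, 179840849,
     95824401, 0, 0, 47680, 0, 47664, 94054929, 0, 0, 47632, 0, 47632, 0, 47632, 0, 47632, 0, 47632,
     77802241, 0, 0, 47664, 1668250444338, 47664, 139082497, 0, 0, 47680] (
    .leaf [⟨656, 2, 1, 38, [52032, 52080, 0, 0, 52080, 52112, 0, 52032, 0, 52032, 52080, 0,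
      76769998323730, 52032]⟩,
      ⟨384, 1, 1, 0, [52080, 0, 0, 52080, 0, 0, 0, 0, 0, 52080, 0, 213893757219186, 52080]⟩,
      ⟨1376, 0, 0, 0, [52048, 52064, 0, 0, 52048, 0, 0, 0, 0, 52048]⟩,
      ⟨328, 0, 0, 0, [52016, 0, 0, 52016, 0, 0, 0, 0, 52016]⟩,
      ⟨1668, 1, 1, 0, [52000, 0, 0, 0, 0, 0, 52080, 0, 52000, 52000]⟩,
      ⟨578, 2, 2, 0, [51984, 0, 51984, 51984, 51984]⟩,
      ⟨106, 0, 0, 0, [51984, 0, 0, 0, 0, 52016]⟩,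
      ⟨26, 2, 2, 0, [51984, 51984, 51984]⟩,
      ⟨38, 2, 2, 0, [51984, 51984]⟩,
      ⟨534, 2, 2, 0, [51984]⟩,
      ⟨1409, 1, 1, 0, [51968, 0, 51968, 51968]⟩,
      ⟨297, 0, 0, 0, [51968]⟩,
      ⟨1061, 1, 1, 0, [51968, 51968]⟩,
      ⟨149, 1, 1, 0, [51968]⟩]) (
   .leaf [⟨656, 2, 1, 38, [47680, 47728, 47728, 47760, 0, 0, 0, 47728, 47760, 0, 0, 47680, 47728, 0,
     47680, 18234206634786, 47680]⟩,
     ⟨640, 1, 1, 0, [47728, 47728, 0, 0, 0, 0, 0, 0, 0, 0, 0, 47728, 0, 195647009, 195638849,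
       47728]⟩,
     ⟨384, 1, 1, 0, [47728, 0, 0, 0, 0, 0, 0, 0, 0, 0, 47728, 0, 198500560818546, 196301571109234,
       47728]⟩,
     ⟨576, 2, 2, 0, [47712, 0, 0, 0, 47760, 47712, 0, 199664749658210, 47760]⟩,
     ⟨320, 0, 0, 0, [47712, 47712, 47712, 0, 0, 47712, 0, 0, 0, 47744]⟩,
     ⟨352, 0, 0, 0, [47696, 47712, 0, 0, 47696, 0, 0, 0, 47696]⟩,
     ⟨328, 0, 0, 0, [47664, 0, 0, 47664, 0, 0, 0, 47664]⟩,
     ⟨644, 2, 2, 0, [47648, 47760, 0, 47648, 47648]⟩,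
     ⟨578, 2, 2, 0, [47632, 0, 47632, 47632]⟩,
     ⟨106, 0, 0, 0, [47632, 0, 0, 0, 47664]⟩,
     ⟨38, 2, 2, 0, [47632, 47632]⟩,
     ⟨534, 2, 2, 0, [47632]⟩,
     ⟨385, 1, 1, 0, [47616, 0, 47616, 47616, 47616]⟩,
     ⟨297, 0, 0, 0, [47616]⟩,
     ⟨25, 1, 1, 0, [47616, 47616, 47616]⟩,
     ⟨37, 1, 1, 0, [47616, 47616]⟩,
     ⟨149, 1, 1, 0, [47616]⟩])) (
  .branch 384 [0, 43376, 0, 43376, 0, 0, 0, 43392, 0, 43392, 0, 43376, 0, 43392, 0, 43376, 0,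
    161547041, 61213057, 0, 0, 144324097, 0, 144332289, 0, 0, 0, 43376, 127412737, 0, 144128513, 0,
    0, 43376] (
   .leaf [⟨128, 0, 0, 0, [47728, 47728, 0, 0, 0, 0, 47728, 0, 47728, 0, 0, 0, 0, 0, 0, 47728, 0, 0,
     47728]⟩,
     ⟨384, 0, 0, 0, [47728, 0, 0, 0, 0, 47728, 0, 47728, 0, 0, 0, 0, 0, 0, 47728, 0, 0, 47728]⟩,
     ⟨64, 1, 1, 0, [47712, 47712, 47712, 47712, 0, 47712, 0, 47712, 47712]⟩,
     ⟨576, 1, 1, 0, [47712, 47712, 47712, 0, 47712, 0, 47712, 47712]⟩,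
     ⟨320, 1, 1, 0, [47712, 47712, 0, 47712, 0, 47712, 47712]⟩,
     ⟨352, 1, 1, 0, [47696, 0, 47712, 0, 47712, 47696]⟩,
     ⟨144, 0, 0, 0, [47680, 0, 47728, 0, 0, 0, 0, 0, 0, 47728, 0, 0, 47680]⟩,
     ⟨328, 1, 1, 0, [47664, 0, 47712, 47664]⟩,
     ⟨132, 0, 0, 0, [47648, 0, 0, 0, 0, 0, 0, 47728, 0, 0, 47648]⟩,
     ⟨66, 1, 1, 0, [47632, 47632]⟩,
     ⟨618, 1, 1, 0, [47632]⟩,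
     ⟨26, 2, 2, 0, [47632, 47632, 47632, 47632, 0, 47664, 47985632432498]⟩,
     ⟨38, 2, 2, 0, [47632, 47632, 47632, 0, 83161414709618, 47648]⟩,
     ⟨22, 2, 2, 0, [47632, 47632, 0, 47680, 47648]⟩,
     ⟨534, 2, 2, 0, [47632, 0, 47680, 47648]⟩,
     ⟨385, 0, 0, 0, [47616, 0, 0, 47616]⟩,
     ⟨537, 2, 2, 0, [47616, 47616]⟩,
     ⟨549, 2, 2, 0, [47616]⟩,
     ⟨149, 0, 0, 0, [47616]⟩]) (
  .branch 38 [153635441, 161953857, 135879265, 0, 145099089, 162023217, 0, 43344, 43059777, 0,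
    74070289, 0, 0, 43296, 0, 43280, 0, 43280, 0, 43280, 0, 43280, 0, 43280, 72952321, 0, 123283969,
    0, 0, 43296, 0, 43296] (
   .leaf [⟨132, 1, 2, 26, [47648, 0, 0, 47728, 0, 0, 0, 0, 47648, 47648, 47728, 39326473367570,
     47648, 47648]⟩,
     ⟨576, 0, 0, 0, [47712, 47712, 0, 47712, 47712, 47712]⟩,
     ⟨352, 0, 0, 0, [47696, 0, 47712, 47712, 47696]⟩,
     ⟨656, 2, 2, 0, [47680, 0, 0, 0, 0, 0, 0, 47728, 47680]⟩,
     ⟨840, 0, 0, 0, [47664, 47712, 47664]⟩,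
     ⟨66, 0, 0, 0, [47632, 47632]⟩,
     ⟨106, 0, 0, 0, [47632]⟩,
     ⟨26, 1, 1, 0, [47632, 47632, 47632, 0, 0, 76632559357970, 47680]⟩,
     ⟨38, 1, 1, 0, [47632, 47632, 0, 0, 47648, 47648]⟩,
     ⟨22, 1, 1, 0, [47632, 0, 0, 47648, 47648]⟩,
     ⟨897, 2, 2, 0, [47616, 47616]⟩,
     ⟨537, 2, 2, 0, [47616]⟩,
     ⟨37, 1, 1, 0, [47616, 47616]⟩,
     ⟨149, 1, 1, 0, [47616]⟩]) (
  .leaf [⟨128, 2, 2, 0, [43376, 0, 0, 0, 0, 0, 43376, 0, 0, 0, 0, 43376, 0, 127535169]⟩,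
    ⟨64, 1, 1, 0, [43360, 43360, 43360, 0, 43360, 0, 43360, 43360]⟩,
    ⟨320, 1, 1, 0, [43360, 43360, 0, 43360, 0, 43360, 43360]⟩,
    ⟨352, 1, 1, 0, [43344, 0, 43360, 0, 43360, 43344]⟩,
    ⟨144, 0, 0, 0, [43328, 0, 0, 0, 0, 43328, 43328, 0, 43328, 0, 43328]⟩,
    ⟨328, 1, 1, 0, [43312, 0, 43360, 43312]⟩,
    ⟨132, 2, 2, 0, [43296, 0, 0, 0, 0, 43376, 0, 43296]⟩,
    ⟨66, 1, 1, 0, [43280, 43280]⟩,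
    ⟨106, 1, 1, 0, [43280]⟩,
    ⟨26, 0, 0, 0, [43280, 43280, 0, 43312, 0, 43328]⟩,
    ⟨22, 0, 0, 0, [43280, 0, 43328, 0, 43296]⟩,
    ⟨385, 2, 2, 0, [43264, 0, 43264]⟩,
    ⟨25, 0, 0, 0, [43264, 0, 43264]⟩,
    ⟨37, 2, 2, 0, [43264]⟩,
    ⟨149, 0, 0, 0, [43264]⟩])))) (
 .branch 21 [0, 0, 0, 0, 0, 0, 156710913, 0, 0, 38976, 154621953, 0, 0, 38944, 88615185, 0, 0, 0, 0,
   0, 154621953, 38976, 156710913, 38944, 0, 38912, 156702753, 38912, 155723537, 38912, 153634577,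
   38912, 0, 38912, 0, 38912] (
  .leaf [⟨21, 0, 1, 128, [43264, 177374993, 0, 0, 0, 177374993, 0, 0, 43328, 0, 43296, 0, 188196865,
    0, 188196865, 0, 43264, 43264]⟩,
    ⟨0, 1, 1, 0, [57739921, 0, 0, 0, 57739921, 0, 0, 0, 0, 0, 0, 161708033, 0, 161708033]⟩,
    ⟨256, 2, 2, 0, [43392, 0, 43392, 0, 43392, 43392, 0, 43392, 0, 43392, 0, 43392, 0, 43392]⟩,
    ⟨128, 0, 0, 0, [43376, 0, 0, 0, 0, 43376, 0, 43376, 0, 0, 0, 0, 0, 43376, 43376]⟩,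
    ⟨384, 2, 2, 0, [43376, 0, 43392, 43392, 0, 43392, 0, 43392, 0, 43392, 0, 43392]⟩,
    ⟨64, 1, 1, 0, [43360, 0, 0, 0, 0, 0, 0, 161708033, 0, 43360]⟩,
    ⟨320, 2, 2, 0, [43360, 43360, 0, 43360, 0, 43360, 0, 43392, 0, 43360]⟩,
    ⟨352, 2, 2, 0, [43344, 0, 43360, 0, 43360, 0, 43344, 0, 43344]⟩,
    ⟨144, 0, 0, 0, [43328, 0, 43376, 0, 0, 0, 0, 0, 43376, 43328]⟩,
    ⟨328, 2, 2, 0, [43312, 0, 43360, 0, 43312, 0, 43312]⟩,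
    ⟨132, 0, 0, 0, [43296, 0, 0, 0, 0, 0, 43376, 43296]⟩,
    ⟨322, 2, 2, 0, [43280, 0, 43280, 0, 43280]⟩,
    ⟨42, 1, 1, 0, [43280, 0, 43280]⟩,
    ⟨298, 2, 2, 0, [43280, 0, 43280]⟩,
    ⟨106, 1, 1, 0, [43280]⟩,
    ⟨362, 2, 2, 0, [43280]⟩,
    ⟨129, 0, 0, 0, [43264, 43264]⟩,
    ⟨149, 0, 0, 0, [43264]⟩]) (
 .branch 37 [0, 73865601, 0, 0, 0, 0, 0, 38992, 77019137, 0, 72878385, 0, 0, 38944, 72886545, 0,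
   136726801, 38992, 0, 38992, 121194497, 0, 0, 38944, 0, 38912, 0, 38912, 0, 38912, 0, 38912, 0,
   38912] (
  .fold [⟨0, 0, [57739921], [161953793, 52824721, 57739921, 162014993, 161825025, 161763585,
    161685761, 161624321, 161547041, 161708033, 91622033, 58067601]⟩] <|
  .branch 38 [153619057, 161953793, 0, 145299009, 140057185, 0, 145115409, 162006833, 0, 43344,
    144992529, 0, 74070289, 0, 0, 43296, 0, 43280, 0, 43280, 0, 43280, 0, 43280, 72952321, 0, 0,
    43344, 123283969, 0, 0, 43296, 0, 43296] (
   .leaf [⟨132, 2, 1, 41, [47648, 47728, 0, 96084225, 47728, 0, 0, 0, 0, 47648, 47728, 0,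
     55617602224386, 47648, 47648]⟩,
     ⟨384, 1, 1, 0, [47728, 0, 0, 47728, 0, 0, 0, 0, 0, 47728, 0, 143602405945714, 0, 47728]⟩,
     ⟨576, 0, 0, 0, [47712, 0, 0, 47712, 47712, 47712, 164424676687970]⟩,
     ⟨96, 2, 2, 0, [47696, 0, 0, 0, 0, 0, 47696, 0, 47696, 0, 47696]⟩,
     ⟨912, 1, 1, 0, [47680, 0, 0, 0, 0, 0, 47728, 0, 47680, 0, 47680]⟩,
     ⟨840, 0, 0, 0, [47664, 47712, 47664, 47664]⟩,
     ⟨322, 0, 0, 0, [47632, 47632, 47632]⟩,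
     ⟨106, 0, 0, 0, [47632, 47632]⟩,
     ⟨282, 0, 0, 0, [47632]⟩,
     ⟨38, 2, 2, 0, [47632, 0, 47696, 0, 47648]⟩,
     ⟨641, 1, 1, 0, [47616, 0, 47616, 0, 47616]⟩,
     ⟨41, 2, 2, 0, [47616, 0, 47616]⟩,
     ⟨537, 1, 1, 0, [47616, 0, 47616]⟩,
     ⟨37, 2, 2, 0, [47616]⟩,
     ⟨149, 1, 1, 0, [47616]⟩]) (
  .branch 282 [77073009, 0, 0, 43392, 92871265, 0, 0, 43392, 94775569, 0, 0, 43328, 0, 43312,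
    76614177, 0, 0, 43280, 0, 43280, 0, 43280, 76753409, 0, 0, 43312, 0, 43312, 121195009, 0, 0,
    43328] (
   .leaf [⟨644, 2, 1, 41, [47648, 47728, 47728, 47760, 0, 47760, 47728, 0, 0, 0, 0, 47728, 0,
     92992407388418, 47648, 47648]⟩,
     ⟨640, 1, 1, 0, [47728, 47728, 0, 0, 0, 47728, 0, 0, 0, 0, 47728, 0, 195630625, 0, 47728]⟩,
     ⟨384, 1, 1, 0, [47728, 0, 0, 0, 47728, 0, 0, 0, 0, 47728, 0, 198565102309746, 0, 47728]⟩,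
     ⟨576, 2, 2, 0, [47712, 0, 47712, 0, 0, 0, 0, 0, 0, 162407815737442, 0, 47760]⟩,
     ⟨320, 0, 0, 0, [47712, 0, 0, 47712, 47712, 47712, 47744]⟩,
     ⟨608, 2, 2, 0, [47696, 0, 0, 0, 0, 0, 0, 47696, 0, 47696]⟩,
     ⟨400, 1, 1, 0, [47680, 0, 0, 0, 0, 47728, 0, 47680, 0, 47680]⟩,
     ⟨328, 0, 0, 0, [47664, 47712, 47664, 47664]⟩,
     ⟨322, 0, 0, 0, [47632, 47632, 47632]⟩,
     ⟨106, 0, 0, 0, [47632, 47632]⟩,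
     ⟨282, 0, 0, 0, [47632]⟩,
     ⟨641, 1, 1, 0, [47616, 0, 47616, 0, 47616]⟩,
     ⟨41, 2, 2, 0, [47616, 0, 47616]⟩,
     ⟨25, 1, 1, 0, [47616, 0, 47616]⟩,
     ⟨549, 2, 2, 0, [47616]⟩,
     ⟨149, 1, 1, 0, [47616]⟩]) (
  .leaf [⟨128, 2, 2, 0, [43376, 43376, 0, 0, 0, 43376, 0, 43376]⟩,
    ⟨384, 2, 2, 0, [43376, 0, 0, 0, 43376, 0, 43376]⟩,
    ⟨64, 0, 0, 0, [43360, 43360, 43360, 0, 43360, 0, 43360, 43360]⟩,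
    ⟨320, 0, 0, 0, [43360, 43360, 0, 43360, 0, 43360, 43360]⟩,
    ⟨96, 0, 0, 0, [43344, 0, 43360, 0, 43360, 43344]⟩,
    ⟨400, 2, 2, 0, [43328, 0, 43376]⟩,
    ⟨328, 0, 0, 0, [43312, 0, 43360, 43312]⟩,
    ⟨132, 2, 2, 0, [43296]⟩,
    ⟨322, 0, 0, 0, [43280, 43280]⟩,
    ⟨106, 0, 0, 0, [43280]⟩,
    ⟨129, 1, 1, 0, [43264, 43264, 43264, 43264, 43264]⟩,
    ⟨41, 1, 1, 0, [43264, 43264, 43264, 43264]⟩,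
    ⟨25, 1, 1, 0, [43264, 43264, 43264]⟩,
    ⟨37, 1, 1, 0, [43264, 43264]⟩,
    ⟨149, 1, 1, 0, [43264]⟩]))) (
 .branch 25 [0, 40311169, 0, 0, 0, 0, 37226833, 0, 0, 38976, 0, 38960, 91826177, 0, 75704593, 0,
   138815761, 38960, 0, 38960, 0, 38960, 123283457, 0, 0, 38912, 0, 38912, 0, 38912, 0, 38912] (
  .leaf [⟨64, 2, 1, 294, [43360, 57739921, 0, 0, 43360, 43360, 0, 43360, 0, 43360, 43360,
    197405713899618, 0, 0, 182190403580002, 161777425]⟩,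
    ⟨0, 1, 1, 0, [57739921, 0, 0, 0, 0, 0, 161685761, 0, 0, 161839105, 91622033, 0, 0, 40311441,
      161777425]⟩,
    ⟨128, 0, 0, 0, [43376, 43376, 0, 0, 43376, 0, 43376, 0, 0, 0, 0, 43376, 0, 0, 43376]⟩,
    ⟨384, 0, 0, 0, [43376, 0, 0, 43376, 0, 43376, 0, 0, 0, 0, 43376, 0, 0, 43376]⟩,
    ⟨320, 2, 2, 0, [43360, 43360, 0, 0, 0, 43360, 0, 0, 43392]⟩,
    ⟨352, 2, 2, 0, [43344, 0, 0, 0, 43360, 0, 0, 43344]⟩,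
    ⟨144, 0, 0, 0, [43328, 0, 43376, 0, 0, 0, 0, 43376, 0, 0, 43328]⟩,
    ⟨72, 1, 1, 0, [43312, 0, 0, 43312, 43312, 0, 0, 43312, 43312]⟩,
    ⟨388, 0, 0, 0, [43296, 0, 0, 0, 0, 43376, 0, 0, 43296]⟩,
    ⟨322, 2, 2, 0, [43280, 0, 0, 43280]⟩,
    ⟨106, 1, 1, 0, [43280, 43280, 0, 0, 43312, 43312]⟩,
    ⟨26, 1, 1, 0, [43280, 0, 0, 43312, 43312]⟩,
    ⟨294, 2, 2, 0, [43280]⟩,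
    ⟨129, 0, 0, 0, [43264, 0, 0, 43264]⟩,
    ⟨41, 1, 1, 0, [43264, 43264]⟩,
    ⟨25, 1, 1, 0, [43264]⟩,
    ⟨149, 0, 0, 0, [43264]⟩]) (
 .leaf [⟨0, 2, 2, 0, [57739649, 0, 57739649, 143999233, 0, 143859969, 0, 143721249]⟩,
   ⟨128, 1, 1, 0, [39024, 0, 0, 39024, 0, 39024, 0, 0, 0, 0, 0, 39024, 0, 39024]⟩,
   ⟨64, 2, 2, 0, [39008, 39008, 0, 39008, 0, 39008]⟩,
   ⟨96, 2, 2, 0, [38992, 0, 39008, 0, 39008]⟩,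
   ⟨144, 1, 1, 0, [38976, 0, 39024, 0, 0, 0, 0, 0, 39024, 0, 38976]⟩,
   ⟨72, 2, 2, 0, [38960, 0, 39008]⟩,
   ⟨132, 1, 1, 0, [38944, 0, 0, 0, 0, 0, 39024, 0, 38944]⟩,
   ⟨66, 2, 2, 0, [38928]⟩,
   ⟨42, 0, 0, 0, [38928, 38928, 38928, 38928, 0, 38960]⟩,
   ⟨106, 0, 0, 0, [38928, 38928, 38928, 0, 38960]⟩,
   ⟨26, 0, 0, 0, [38928, 38928, 0, 38960]⟩,
   ⟨38, 0, 0, 0, [38928, 0, 38992]⟩,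
   ⟨129, 1, 1, 0, [38912, 0, 38912]⟩,
   ⟨41, 0, 0, 0, [38912]⟩,
   ⟨149, 1, 1, 0, [38912]⟩]))))

def spiderGraph : List ℕ := [0, 1, 0, 4, 0, 16, 21]

def spiderRows : List (List ℕ) := [
  [],
  [0, 0, 0, 8448],
  [],
  [0, 0, 0, 17184, 0, 0, 0, 17184, 0, 0, 0, 17184],
  [0, 0, 0, 72556801, 0, 72495361, 0, 72418081, 0, 0, 0, 0, 0, 72356641],
  [0, 0, 0, 25920, 0, 90382593, 0, 72753409, 0, 90243873, 56689985, 0, 0, 25920, 39912769, 0, 0,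
    25920, 0, 72745761, 37094721, 0, 0, 25920, 52823361, 0, 0, 25920],
  [0, 0, 52823889, 0, 0, 30272, 88475441, 0, 0, 30240, 88483601, 0, 0, 31763669251, 0, 30272, 0,
    30240, 0, 30240, 0, 30208, 0, 30208, 0, 30208, 0, 30208, 0, 30208]]

def spiderTree : Refutation :=
 .leaf [⟨0, 0, 0, 0, [52824177, 0, 126173441, 0, 126034177, 0, 125895457]⟩,
   ⟨64, 1, 1, 0, [34656, 0, 126112001, 0, 125972737, 0, 0, 0, 0, 0, 125834017]⟩,
   ⟨96, 0, 0, 0, [34640, 0, 34656, 0, 34656]⟩,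
   ⟨16, 1, 1, 0, [34624, 0, 74981633, 0, 0, 0, 0, 0, 74973985]⟩,
   ⟨72, 0, 0, 0, [34608, 0, 34656]⟩,
   ⟨4, 1, 1, 0, [34592, 0, 0, 0, 0, 0, 41420097]⟩,
   ⟨66, 0, 0, 0, [34576]⟩,
   ⟨42, 2, 2, 0, [34576, 34576, 34576, 34576, 0, 34608, 34608, 34640, 32300540163]⟩,
   ⟨26, 2, 2, 0, [34576, 34576, 34576, 0, 34608, 34608, 32284811523, 34624]⟩,
   ⟨38, 2, 2, 0, [34576, 34576, 0, 34640, 32300478723, 34592, 34592]⟩,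
   ⟨22, 2, 2, 0, [34576, 0, 32284750083, 34624, 34592, 34592]⟩,
   ⟨1, 1, 1, 0, [34560]⟩,
   ⟨41, 2, 2, 0, [34560, 34560, 34560, 34560]⟩,
   ⟨25, 2, 2, 0, [34560, 34560, 34560]⟩,
   ⟨37, 2, 2, 0, [34560, 34560]⟩,
   ⟨21, 2, 2, 0, [34560]⟩]

def threeEdgesGraph : List ℕ := [0, 1, 0, 4, 0, 16]

def threeEdgesRows : List (List ℕ) := [
  [],
  [0, 0, 0, 8448],
  [],
  [0, 0, 0, 17184, 0, 0, 0, 17184, 0, 0, 0, 17184],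
  [0, 0, 0, 72556801, 0, 72495361, 0, 72418081, 0, 0, 0, 0, 0, 72356641],
  [0, 0, 0, 25920, 0, 90382593, 0, 72753409, 0, 90243873, 56689985, 1683107860, 1698836500, 25920,
    39912769, 1683169300, 1698897940, 25920, 0, 72745761, 37094721, 1683108100, 1698836740, 25920,
    52823361, 1683169540, 1698898180, 25920]]

def threeEdgesTree : Refutation :=
 .fold [⟨1, 3, [30208], [123736865, 91620129, 74842913, 0, 41289025]⟩, ⟨2, 2, [0, 30224],
   [123798305, 123798305, 123798305, 123798849]⟩] <|
 .gone 0

def wagnerPlusGraph : List ℕ := [0, 1, 2, 4, 9, 18, 36, 73, 5]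

def wagnerPlusRows : List (List ℕ) := [
  [],
  [0, 0, 0, 8448],
  [0, 0, 0, 12816],
  [0, 0, 0, 17184, 0, 0, 0, 0, 0, 17184],
  [0, 0, 0, 21552, 0, 0, 0, 0, 0, 21552, 0, 21504, 0, 21504, 0, 21504],
  [0, 0, 0, 25920, 0, 0, 0, 0, 0, 25920, 0, 25872, 0, 25872, 0, 25872],
  [0, 54531937, 0, 30288, 0, 0, 105973553, 0, 0, 30288, 0, 30240, 0, 30240, 0, 30240, 0, 0, 0, 0, 0,
    0, 90322689, 0, 0, 30288, 0, 0, 0, 30288, 0, 30240, 0, 30240],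
  [0, 72427633, 37161041, 0, 123869249, 0, 0, 34656, 0, 34608, 0, 34608, 117725217, 0, 0, 0, 0, 0,
    108218385, 0, 0, 34656, 0, 0, 0, 34656, 0, 34608, 0, 34608, 0, 34560, 0, 34560, 0, 34560, 0,
    34560, 0, 34560, 0, 34560, 0, 34560],
  [0, 54860161, 127223841, 0, 127162401, 144127249, 0, 17339479315, 90781697, 143881489, 106510337,
    0, 136934721, 38944, 134691153, 38944, 0, 38944, 0, 38944, 0, 38944, 395597859, 127411521,
    134494561, 143742769, 136739137, 143742769, 127162401, 0, 0, 143742769, 8918554627, 60294737,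
    90781697, 0, 0, 38912, 136542545, 38912, 134821457, 38912, 0, 38912, 0, 38912, 0, 38912, 0,
    38912]]

def wagnerPlusTree : Refutation :=
 .leaf [⟨82, 2, 1, 416, [43280, 0, 0, 43328, 126615808291154, 0, 43328, 43328, 43280, 43280, 43360,
   43360]⟩,
   ⟨0, 0, 0, 0, [52497041, 0, 0, 0, 161637377, 0, 0, 0, 0, 0, 0, 161498657, 161645889, 161814321]⟩,
   ⟨416, 2, 2, 0, [43344, 0, 0, 0, 133401743368482, 43376, 43376]⟩,
   ⟨80, 1, 1, 0, [43328, 110768385, 0, 0, 0, 0, 43360, 43360, 43360]⟩,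
   ⟨296, 1, 1, 0, [43312, 0, 0, 0, 0, 43312, 63042192974082, 43312]⟩,
   ⟨164, 0, 0, 0, [43296, 0, 0, 0, 0, 0, 0, 43344, 43296, 43296]⟩,
   ⟨20, 2, 2, 0, [43296, 43296, 43328]⟩,
   ⟨148, 2, 2, 0, [43296, 43328]⟩,
   ⟨402, 2, 2, 0, [43280]⟩,
   ⟨330, 1, 1, 0, [43280, 43360, 43312]⟩,
   ⟨65, 1, 1, 0, [43264, 43264]⟩,
   ⟨73, 1, 1, 0, [43264]⟩,
   ⟨41, 0, 0, 0, [43264, 43264, 43264]⟩,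
   ⟨5, 0, 0, 0, [43264, 43264]⟩,
   ⟨37, 0, 0, 0, [43264]⟩]

def wagnerPairGraph : List ℕ := [0, 1, 2, 4, 9, 18, 36, 73, 144, 292]

def wagnerPairRows : List (List ℕ) := [
  [],
  [0, 0, 0, 8448],
  [0, 0, 0, 12816],
  [0, 0, 0, 17184, 0, 0, 0, 0, 0, 17184],
  [0, 0, 0, 21552, 0, 0, 0, 0, 0, 21552, 0, 21504, 0, 21504, 0, 21504],
  [0, 0, 0, 25920, 0, 0, 0, 0, 0, 25920, 0, 25872, 0, 25872, 0, 25872],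
  [0, 54531937, 0, 30288, 0, 0, 105973553, 0, 0, 30288, 0, 30240, 0, 30240, 0, 30240, 0, 0, 0, 0, 0,
    0, 90322689, 0, 0, 30288, 0, 0, 0, 30288, 0, 30240, 0, 30240],
  [0, 72427633, 37161041, 567775622742, 123869249, 0, 563194848582, 34656, 0, 34608, 558621938742,
    34608, 117725217, 0, 0, 0, 554174858022, 0, 108218385, 559223828502, 0, 34656, 0, 0, 0, 34656,
    551741043222, 34608, 0, 34608, 554642532102, 34560, 0, 34560, 0, 34560, 0, 34560, 0, 34560,
    581519483142, 34560, 0, 34560],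
  [0, 159855889, 0, 38976, 154633489, 0, 0, 39024, 0, 0, 0, 39024, 0, 38976, 0, 0, 0, 38976, 0,
    38976, 0, 38976, 0, 0, 151291425, 0, 154633489, 0, 154633489, 0, 151291425],
  [0, 177366017, 0, 0, 160051457, 43392, 0, 43296, 0, 43296, 0, 43296, 0, 43296, 0, 43296,
    174232577, 0, 174232577, 43392, 159857169, 0, 0, 0, 159857169, 0, 174232577, 0, 174232577,
    43392, 0, 43344, 0, 43392, 0, 43392, 0, 43344, 0, 43296, 0, 43296]]

def wagnerPairTree : Refutation :=
 .leaf [⟨0, 0, 0, 0, [52497313, 0, 179929345, 0, 0, 0, 0, 0, 179708929, 179906305, 179570209,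
   179570209, 179906305, 179708929]⟩,
   ⟨144, 2, 2, 0, [47680, 0, 47728, 22744236291, 0, 47728, 47680]⟩,
   ⟨656, 0, 0, 0, [47680, 0, 0, 0, 0, 0, 47760, 47680, 47680, 47680, 47680, 47760]⟩,
   ⟨132, 2, 2, 0, [47648, 47648, 0, 47648, 47648]⟩,
   ⟨36, 2, 2, 0, [47648, 0, 47648, 47648]⟩,
   ⟨292, 1, 1, 0, [47648, 0, 0, 0, 0, 0, 0, 0, 0, 47696, 47744, 47744, 47696, 47648, 47648]⟩,
   ⟨164, 2, 2, 0, [47648, 47648]⟩,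
   ⟨148, 2, 2, 0, [47648]⟩,
   ⟨578, 0, 0, 0, [47632, 47632, 47632, 47632, 47632, 47632]⟩,
   ⟨530, 0, 0, 0, [47632, 47632, 47632, 47632, 47632]⟩,
   ⟨146, 0, 0, 0, [47632, 47632, 47632, 47632]⟩,
   ⟨658, 0, 0, 0, [47632, 47632, 47632]⟩,
   ⟨594, 0, 0, 0, [47632, 47632]⟩,
   ⟨586, 0, 0, 0, [47632]⟩,
   ⟨289, 1, 1, 0, [47616, 47616, 47616, 47616, 47616, 47616]⟩,
   ⟨265, 1, 1, 0, [47616, 47616, 47616, 47616, 47616]⟩,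
   ⟨329, 1, 1, 0, [47616, 47616, 47616, 47616]⟩,
   ⟨297, 1, 1, 0, [47616, 47616, 47616]⟩,
   ⟨37, 1, 1, 0, [47616, 47616]⟩,
   ⟨293, 1, 1, 0, [47616]⟩]

def wagnerGraph : List ℕ := [0, 1, 2, 4, 9, 18, 36, 73]

def wagnerRows : List (List ℕ) := [
  [],
  [0, 0, 0, 8448],
  [0, 0, 0, 12816],
  [0, 0, 0, 17184, 0, 0, 0, 0, 0, 17184],
  [0, 0, 0, 21552, 0, 0, 0, 0, 0, 21552, 0, 21504, 0, 21504, 0, 21504],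
  [0, 0, 0, 25920, 0, 0, 0, 0, 0, 25920, 0, 25872, 0, 25872, 0, 25872],
  [0, 54531937, 0, 30288, 0, 0, 105973553, 0, 0, 30288, 0, 30240, 0, 30240, 0, 30240, 0, 0, 0, 0, 0,
    0, 90322689, 0, 0, 30288, 0, 0, 0, 30288, 0, 30240, 0, 30240],
  [0, 72427633, 37161041, 567775622742, 123869249, 0, 563194848582, 34656, 0, 34608, 558621938742,
    34608, 117725217, 0, 0, 0, 554174858022, 0, 108218385, 559223828502, 0, 34656, 0, 0, 0, 34656,
    551741043222, 34608, 0, 34608, 554642532102, 34560, 0, 34560, 0, 34560, 0, 34560, 0, 34560,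
    581519483142, 34560, 0, 34560]]

def wagnerTree : Refutation :=
 .leaf [⟨164, 1, 2, 18, [38944, 0, 39024, 0, 38944, 38944, 38944, 0, 0, 39024, 0, 0, 38992,
   171403537, 0, 38992, 38944]⟩,
   ⟨0, 0, 0, 0, [52496769, 0, 144057345, 0, 0, 0, 144057345, 0, 0, 143742769, 144057345, 0, 0,
     143881489]⟩,
   ⟨144, 1, 1, 0, [38976, 0, 39024, 0, 38976, 0, 38976, 38976]⟩,
   ⟨72, 0, 0, 0, [38960, 0, 0, 0, 39008, 0, 0, 39008, 38960, 0, 0, 38960]⟩,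
   ⟨132, 1, 1, 0, [38944, 0, 38944, 0, 9432588121687, 39024]⟩,
   ⟨36, 2, 2, 0, [38944, 0, 0, 0, 0, 0, 0, 38992, 10467961538407, 0, 38992, 38944]⟩,
   ⟨148, 1, 1, 0, [38944, 0, 38976, 38976]⟩,
   ⟨66, 0, 0, 0, [38928, 0, 0, 38928, 38928, 0, 0, 39008]⟩,
   ⟨18, 1, 1, 0, [38928, 38928]⟩,
   ⟨146, 1, 1, 0, [38928]⟩,
   ⟨82, 0, 0, 0, [38928, 38928, 0, 0, 39008]⟩,
   ⟨74, 0, 0, 0, [38928, 0, 0, 38960]⟩,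
   ⟨33, 2, 2, 0, [38912, 38912, 0, 38912, 38912]⟩,
   ⟨9, 2, 2, 0, [38912, 0, 38912, 38912]⟩,
   ⟨73, 0, 0, 0, [38912]⟩,
   ⟨41, 2, 2, 0, [38912, 38912]⟩,
   ⟨37, 2, 2, 0, [38912]⟩]

def cycle5Graph : List ℕ := [0, 1, 2, 4, 9]

def cycle5Rows : List (List ℕ) := [
  [],
  [0, 0, 0, 8448],
  [0, 0, 0, 12816],
  [0, 0, 0, 17184, 0, 0, 0, 0, 0, 17184],
  [0, 0, 0, 21552, 0, 0, 0, 0, 0, 21552, 0, 21504, 0, 21504, 0, 21504]]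

def cycle5Tree : Refutation :=
 .branch 0 [0, 52495953, 0, 52495953, 0, 67184209, 0, 54531665, 0, 0, 0, 36963921, 0, 0, 0, 0, 0,
   70391377] (
  .branch 52 [0, 0, 0, 30272, 1164390660, 90648833, 0, 30240, 0, 30240, 0, 30240, 90453777, 0, 0,
    30272, 0, 30272, 57738833, 0, 0, 30288, 90322689, 0, 57677393, 0, 0, 30288, 0, 30240, 0, 30240]
    (
   .branch 50 [0, 0, 0, 0, 0, 34624, 91490337, 0, 0, 34624, 0, 34624, 0, 34576, 0, 34576, 0, 34576,
     0, 34576, 10293036822, 34576, 26934917123, 91751201, 37226321, 0, 0, 34640, 52954961, 0,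
     212424738342, 34640] (
    .leaf [⟨0, 1, 1, 0, [52496769, 0, 0, 0, 52496769, 0, 143800145, 144007425, 0, 143722065,
      144012065]⟩,
      ⟨128, 2, 2, 0, [39024, 0, 0, 0, 39024, 0, 0, 0, 0, 0, 0, 0, 126420513, 39024]⟩,
      ⟨64, 0, 0, 0, [39008, 39008, 0, 0, 0, 0, 39008, 0, 0, 39008, 39008]⟩,
      ⟨192, 0, 0, 0, [39008, 0, 0, 0, 0, 39008, 0, 0, 39008, 39008]⟩,
      ⟨16, 1, 1, 0, [38976, 0, 38976, 38976, 0, 38976, 38976]⟩,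
      ⟨132, 2, 2, 0, [38944, 0, 0, 0, 0, 0, 0, 0, 416771687206, 38944]⟩,
      ⟨20, 1, 1, 0, [38944, 38944, 0, 38976, 38976]⟩,
      ⟨52, 1, 1, 0, [38944, 0, 38976, 38976]⟩,
      ⟨66, 0, 0, 0, [38928, 0, 0, 38928, 39008]⟩,
      ⟨18, 1, 1, 0, [38928, 38928]⟩,
      ⟨50, 1, 1, 0, [38928]⟩,
      ⟨74, 0, 0, 0, [38928, 38960]⟩,
      ⟨201, 0, 0, 0, [38912]⟩,
      ⟨41, 2, 2, 0, [38912, 38912]⟩,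
      ⟨133, 2, 2, 0, [38912]⟩]) (
   .leaf [⟨64, 0, 2, 18, [34656, 0, 0, 0, 0, 0, 34656, 0, 34656, 10327640086, 34656, 34656,
     106510353, 0, 55056721]⟩,
     ⟨0, 1, 1, 0, [52496497, 52496497, 90441841, 1199923460, 126181633, 0, 0, 0, 0, 0, 0, 0,
       125834833]⟩,
     ⟨16, 1, 1, 0, [34624, 1215652100, 34624, 34624, 0, 0, 0, 0, 0, 0, 0, 125834833]⟩,
     ⟨4, 1, 1, 0, [34592, 34592, 34592, 0, 0, 0, 0, 0, 0, 0, 34592]⟩,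
     ⟨20, 1, 1, 0, [34592, 34592, 0, 0, 0, 0, 0, 0, 0, 34592]⟩,
     ⟨52, 1, 1, 0, [34592, 0, 0, 0, 0, 0, 0, 0, 34592]⟩,
     ⟨66, 0, 0, 0, [34576, 34576, 34576]⟩,
     ⟨18, 0, 0, 0, [34576, 34576]⟩,
     ⟨74, 0, 0, 0, [34576]⟩,
     ⟨42, 2, 2, 0, [34576, 352460175462, 34608, 34608, 0, 34640]⟩,
     ⟨65, 2, 2, 0, [34560, 34560, 34560, 0, 34560]⟩,
     ⟨73, 2, 2, 0, [34560, 34560, 0, 34560]⟩,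
     ⟨41, 2, 2, 0, [34560, 0, 34560]⟩,
     ⟨5, 1, 1, 0, [34560]⟩,
     ⟨37, 2, 2, 0, [34560]⟩])) (
  .branch 50 [0, 0, 0, 30272, 90244913, 0, 90441505, 0, 0, 30272, 0, 30224, 0, 30224, 0, 30224, 0,
    30224, 0, 30224, 358819588, 90637089, 37160529, 0, 0, 30288, 52889169, 0, 0, 30288] (
   .leaf [⟨64, 0, 2, 20, [34656, 0, 0, 34656, 34656, 0, 0, 0, 0, 0, 42207569, 34656, 106498081,
     34656, 212190906406]⟩,
     ⟨0, 1, 1, 0, [52496497, 52496497, 0, 0, 0, 36964465, 394617636, 126182177, 126035537]⟩,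
     ⟨16, 1, 1, 0, [34624, 0, 0, 0, 394617636, 34624, 34624, 126035537]⟩,
     ⟨72, 2, 2, 0, [34608, 0, 0, 0, 0, 0, 0, 34608, 34608, 34608, 0, 348483782502]⟩,
     ⟨68, 0, 0, 0, [34592, 34592, 0, 0, 0, 0, 0, 0, 0, 34592]⟩,
     ⟨20, 0, 0, 0, [34592, 0, 0, 0, 0, 0, 0, 0, 34592]⟩,
     ⟨2, 1, 1, 0, [34576, 34576, 34576, 34576]⟩,
     ⟨18, 1, 1, 0, [34576, 34576, 34576]⟩,
     ⟨50, 1, 1, 0, [34576, 34576]⟩,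
     ⟨10, 1, 1, 0, [34576]⟩,
     ⟨42, 2, 2, 0, [34576, 34608, 34608, 0, 34640]⟩,
     ⟨73, 2, 2, 0, [34560, 34560, 0, 34560]⟩,
     ⟨41, 2, 2, 0, [34560, 0, 34560]⟩,
     ⟨69, 0, 0, 0, [34560]⟩,
     ⟨37, 2, 2, 0, [34560]⟩]) (
  .branch 42 [0, 0, 90253121, 0, 0, 30256, 359080964, 90645505, 41158225, 0, 0, 30224, 0, 30224, 0,
    30224, 0, 30224, 90384129, 0, 0, 30256, 0, 30256, 67577425, 0, 0, 30288] (
   .leaf [⟨0, 1, 1, 0, [52496497, 0, 0, 90245233, 0, 36964465, 126092881, 394617860, 126182401]⟩,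
     ⟨64, 0, 0, 0, [34656, 34656, 0, 34656, 0, 0, 0, 0, 34656, 0, 0, 34656]⟩,
     ⟨80, 0, 0, 0, [34624, 0, 34624, 0, 0, 0, 0, 34656, 0, 0, 34656]⟩,
     ⟨8, 1, 1, 0, [34608, 0, 394617860, 126092881, 34608, 34608]⟩,
     ⟨84, 0, 0, 0, [34592, 0, 0, 0, 0, 34656, 0, 0, 34592]⟩,
     ⟨2, 1, 1, 0, [34576, 34576, 34576, 34576]⟩,
     ⟨18, 1, 1, 0, [34576, 34576, 34576]⟩,
     ⟨10, 1, 1, 0, [34576, 34576]⟩,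
     ⟨42, 1, 1, 0, [34576]⟩,
     ⟨65, 0, 0, 0, [34560, 0, 0, 34560]⟩,
     ⟨9, 2, 2, 0, [34560, 34560, 0, 34560]⟩,
     ⟨41, 2, 2, 0, [34560, 0, 34560]⟩,
     ⟨69, 0, 0, 0, [34560]⟩,
     ⟨37, 2, 2, 0, [34560]⟩]) (
  .dominated 5 0)))) (
 .branch 4 [0, 0, 0, 0, 0, 25888, 0, 25888, 0, 0, 0, 0, 0, 0, 0, 0, 0, 0, 0, 25888] (
  .branch 40 [106043201, 0, 123089153, 30288, 121000193, 30256, 0, 30256, 119890945, 0, 121640529,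
    0, 90392337, 124068865, 0, 30288, 0, 0, 0, 30288, 118507089, 30256, 0, 30256, 0, 0, 0, 30288, 0,
    30256, 0, 30256] (
   .leaf [⟨40, 1, 2, 18, [34608, 0, 0, 0, 34640, 0, 0, 34640, 34608, 151291169, 0, 34640, 34608,
     34608, 151094833]⟩,
     ⟨80, 0, 0, 0, [34624, 34656, 34624, 0, 0, 34624, 0, 0, 0, 34656, 0, 0, 0, 0, 34656]⟩,
     ⟨68, 0, 0, 0, [34592, 34592, 0, 0, 34656, 0, 0, 0, 34656, 0, 0, 0, 0, 34592]⟩,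
     ⟨84, 0, 0, 0, [34592, 0, 0, 34624, 0, 0, 0, 34656, 0, 0, 0, 0, 34592]⟩,
     ⟨34, 1, 1, 0, [34576, 34576, 0, 34576, 34576]⟩,
     ⟨18, 1, 1, 0, [34576, 0, 34576, 34576]⟩,
     ⟨82, 0, 0, 0, [34576, 0, 0, 0, 34656, 0, 0, 0, 0, 34656]⟩,
     ⟨50, 1, 1, 0, [34576, 34576]⟩,
     ⟨42, 1, 1, 0, [34576]⟩,
     ⟨1, 2, 2, 0, [34560, 0, 34560, 34560, 34560, 34560]⟩,
     ⟨65, 0, 0, 0, [34560, 0, 0, 0, 0, 34560]⟩,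
     ⟨33, 2, 2, 0, [34560, 34560, 34560, 34560]⟩,
     ⟨9, 2, 2, 0, [34560, 34560, 34560]⟩,
     ⟨41, 2, 2, 0, [34560, 34560]⟩,
     ⟨5, 2, 2, 0, [34560]⟩,
     ⟨69, 0, 0, 0, [34560]⟩]) (
  .branch 48 [0, 30272, 0, 30272, 1164390660, 90648833, 0, 0, 0, 30272, 90453777, 0, 0, 30288, 0,
    30272, 0, 30272, 57738833, 0, 0, 30288, 106051329, 0, 0, 30288, 57677393, 0, 0, 30288] (
   .branch 74 [118642753, 126092577, 57739345, 0, 123996193, 125981697, 0, 34656, 0, 0, 0, 34576,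
     120850513, 34576, 0, 34576, 31761582102, 34576, 0, 34576, 0, 34576, 120739841, 34656,
     108210177, 0, 0, 34608, 0, 34608, 90650625, 0, 357557561382, 34656] (
    .leaf [⟨176, 0, 0, 0, [38976, 0, 38976, 38976, 0, 0, 0, 0, 38992, 0, 0, 39024]⟩,
      ⟨68, 1, 1, 0, [38944, 0, 0, 39008, 31811914006, 39008]⟩,
      ⟨20, 0, 0, 0, [38944, 38944, 0, 0, 0, 0, 91881042726, 0, 0, 38944]⟩,
      ⟨148, 0, 0, 0, [38944, 0, 0, 0, 0, 39024, 0, 0, 38944]⟩,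
      ⟨66, 1, 1, 0, [38928, 38928, 38928]⟩,
      ⟨18, 1, 1, 0, [38928, 38928]⟩,
      ⟨74, 1, 1, 0, [38928]⟩,
      ⟨42, 2, 2, 0, [38928, 0, 38960, 38960]⟩,
      ⟨161, 0, 0, 0, [38912, 0, 0, 38912]⟩,
      ⟨73, 2, 2, 0, [38912, 38912]⟩,
      ⟨41, 2, 2, 0, [38912]⟩,
      ⟨133, 0, 0, 0, [38912]⟩]) (
   .branch 41 [122820673, 126116369, 0, 34640, 117729313, 125965889, 57677921, 0, 0, 0, 91441169, 0,
     120875025, 34640, 106379281, 0, 425755891782, 34640, 0, 34608, 120723553, 34560, 0, 34560, 0,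
     34560, 0, 34560, 0, 34560, 100231489542, 34560] (
    .leaf [⟨48, 2, 2, 0, [38976, 0, 0, 0, 0, 0, 0, 0, 0, 0, 100265044230]⟩,
      ⟨196, 1, 1, 0, [38944, 38944, 38944, 39008, 39024]⟩,
      ⟨20, 1, 1, 0, [38944, 38944, 347968467750, 38976]⟩,
      ⟨148, 1, 1, 0, [38944, 39024, 38976]⟩,
      ⟨194, 1, 1, 0, [38928, 38928]⟩,
      ⟨146, 1, 1, 0, [38928]⟩,
      ⟨42, 0, 0, 0, [38928, 38992, 38960, 38960]⟩,
      ⟨33, 0, 0, 0, [38912, 38912, 38912]⟩,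
      ⟨73, 0, 0, 0, [38912, 38912]⟩,
      ⟨41, 0, 0, 0, [38912]⟩,
      ⟨5, 2, 2, 0, [38912]⟩]) (
   .leaf [⟨16, 2, 2, 0, [34624, 0, 1215652100, 126243073, 34624, 0, 0, 0, 0, 0, 0, 0, 0,
     125834833]⟩,
     ⟨48, 0, 0, 0, [34624, 0, 0, 0, 0, 34640, 34624, 34624, 34640]⟩,
     ⟨4, 2, 2, 0, [34592, 34592, 34592, 0, 0, 0, 0, 0, 0, 0, 0, 34592]⟩,
     ⟨68, 2, 2, 0, [34592, 34592, 0, 0, 0, 0, 0, 0, 0, 0, 34592]⟩,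
     ⟨20, 2, 2, 0, [34592, 0, 0, 0, 0, 0, 0, 0, 0, 34592]⟩,
     ⟨66, 1, 1, 0, [34576, 0, 0, 0, 0, 34656, 108528417, 34656, 0, 34656]⟩,
     ⟨34, 0, 0, 0, [34576, 34576, 34576, 34576]⟩,
     ⟨18, 0, 0, 0, [34576, 34576, 34576]⟩,
     ⟨50, 0, 0, 0, [34576, 34576]⟩,
     ⟨42, 0, 0, 0, [34576]⟩,
     ⟨65, 1, 1, 0, [34560, 34560, 34560, 0, 34560]⟩,
     ⟨33, 1, 1, 0, [34560, 34560, 0, 34560]⟩,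
     ⟨73, 1, 1, 0, [34560, 0, 34560]⟩,
     ⟨5, 2, 2, 0, [34560]⟩,
     ⟨69, 1, 1, 0, [34560]⟩]))) (
  .branch 50 [0, 30272, 90244913, 0, 0, 0, 0, 30272, 0, 30224, 0, 30224, 0, 30224, 0, 30224, 0,
    30224, 0, 30224, 106051329, 0, 0, 30288, 0, 0, 31512011016, 30288] (
   .leaf [⟨16, 1, 1, 0, [34624, 0, 90245233, 0, 34624, 0, 0, 0, 0, 0, 0, 0, 101857393]⟩,
     ⟨72, 2, 2, 0, [34608, 0, 34656, 0, 0, 0, 0, 0, 0, 0, 34656, 0, 34608, 34608, 357564899622,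
       34656]⟩,
     ⟨4, 1, 1, 0, [34592, 0, 34592, 0, 0, 0, 0, 0, 0, 0, 54925425]⟩,
     ⟨68, 2, 2, 0, [34592, 0, 0, 0, 0, 0, 0, 0, 34656, 0, 36343849224, 34656, 34592, 34592]⟩,
     ⟨20, 1, 1, 0, [34592, 0, 0, 0, 0, 0, 0, 0, 210593269542]⟩,
     ⟨2, 0, 0, 0, [34576, 34576, 34576, 34576, 34576, 34576]⟩,
     ⟨34, 0, 0, 0, [34576, 34576, 34576, 34576, 34576]⟩,
     ⟨18, 0, 0, 0, [34576, 34576, 34576, 34576]⟩,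
     ⟨50, 0, 0, 0, [34576, 34576, 34576]⟩,
     ⟨10, 0, 0, 0, [34576, 34576]⟩,
     ⟨42, 0, 0, 0, [34576]⟩,
     ⟨65, 2, 2, 0, [34560, 0, 34560, 34560, 34560, 34560]⟩,
     ⟨33, 1, 1, 0, [34560]⟩,
     ⟨9, 2, 2, 0, [34560, 34560, 34560, 34560]⟩,
     ⟨73, 2, 2, 0, [34560, 34560, 34560]⟩,
     ⟨5, 2, 2, 0, [34560, 34560]⟩,
     ⟨69, 2, 2, 0, [34560]⟩]) (
  .leaf [⟨16, 0, 2, 4, [30272, 123995425, 0, 30272, 123995425, 139621377, 30272, 123995425,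
    139621377]⟩,
    ⟨8, 2, 2, 0, [30256, 0, 0, 376775684, 108340225, 108266785, 30256, 30256]⟩,
    ⟨4, 0, 0, 0, [30240, 30240]⟩,
    ⟨20, 0, 0, 0, [30240]⟩,
    ⟨2, 2, 2, 0, [30224, 30224, 30224, 30224, 30224]⟩,
    ⟨34, 2, 2, 0, [30224, 30224, 30224, 30224]⟩,
    ⟨18, 2, 2, 0, [30224, 30224, 30224]⟩,
    ⟨10, 2, 2, 0, [30224, 30224]⟩,
    ⟨42, 2, 2, 0, [30224]⟩,
    ⟨1, 1, 1, 0, [30208, 30208, 30208, 30208, 30208]⟩,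
    ⟨33, 1, 1, 0, [30208, 30208, 30208, 30208]⟩,
    ⟨9, 1, 1, 0, [30208, 30208, 30208]⟩,
    ⟨41, 1, 1, 0, [30208, 30208]⟩,
    ⟨5, 1, 1, 0, [30208]⟩])))) (
 .branch 16 [0, 25920, 0, 0, 0, 25920, 0, 0, 0, 25920] (
  .branch 37 [0, 0, 90183473, 0, 0, 30288, 0, 30240, 106182417, 0, 0, 30288, 0, 0, 0, 0,
    18025378056, 30288, 0, 30208, 0, 30208, 0, 30208, 0, 30208, 0, 30208, 0, 30208] (
   .leaf [⟨16, 0, 0, 0, [34624, 0, 0, 0, 34624, 0, 52824177, 34624, 34624]⟩,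
     ⟨80, 2, 2, 0, [34624, 34656, 0, 0, 34656, 0, 0, 0, 18025513224, 34656]⟩,
     ⟨72, 2, 2, 0, [34608, 0, 0, 34656, 0, 0, 0, 34608, 34608]⟩,
     ⟨40, 1, 1, 0, [34608, 0, 0, 0, 0, 0, 0, 0, 141902353, 34640, 34608, 34608, 36329108488,
       34640]⟩,
     ⟨20, 0, 0, 0, [34592, 0, 233405695782, 34624, 34624]⟩,
     ⟨66, 2, 2, 0, [34576, 0, 0, 0, 34576, 34576]⟩,
     ⟨34, 0, 0, 0, [34576, 34576, 34576]⟩,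
     ⟨18, 0, 0, 0, [34576, 34576]⟩,
     ⟨82, 0, 0, 0, [34576]⟩,
     ⟨10, 2, 2, 0, [34576, 34576]⟩,
     ⟨74, 2, 2, 0, [34576]⟩,
     ⟨1, 1, 1, 0, [34560, 34560, 34560, 34560, 34560, 34560]⟩,
     ⟨33, 1, 1, 0, [34560, 34560, 34560, 34560, 34560]⟩,
     ⟨9, 1, 1, 0, [34560, 34560, 34560, 34560]⟩,
     ⟨41, 1, 1, 0, [34560, 34560, 34560]⟩,
     ⟨5, 1, 1, 0, [34560, 34560]⟩,
     ⟨37, 1, 1, 0, [34560]⟩]) (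
  .leaf [⟨16, 0, 2, 5, [30272, 0, 0, 30272, 135427393, 52889681, 30272, 135427393, 18026496264]⟩,
    ⟨8, 1, 1, 0, [30256, 30256, 0, 0, 0, 0, 0, 0, 108347924, 108347921, 30256, 30256]⟩,
    ⟨40, 1, 1, 0, [30256, 0, 0, 0, 0, 0, 0, 124076561, 30288, 30256, 30256]⟩,
    ⟨20, 0, 0, 0, [30240, 0, 0, 0, 0, 0, 0, 0, 0, 0, 30240]⟩,
    ⟨2, 2, 2, 0, [30224, 30224, 30224, 30224, 30224]⟩,
    ⟨34, 2, 2, 0, [30224, 30224, 30224, 30224]⟩,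
    ⟨18, 2, 2, 0, [30224, 30224, 30224]⟩,
    ⟨10, 2, 2, 0, [30224, 30224]⟩,
    ⟨42, 2, 2, 0, [30224]⟩,
    ⟨1, 1, 1, 0, [30208, 30208, 30208, 30208]⟩,
    ⟨33, 1, 1, 0, [30208, 30208, 30208]⟩,
    ⟨9, 1, 1, 0, [30208, 30208]⟩,
    ⟨41, 1, 1, 0, [30208]⟩,
    ⟨5, 0, 0, 0, [30208]⟩])) (
 .branch 1 [0, 0, 0, 0, 0, 0, 0, 0, 0, 0, 0, 25856, 0, 25856, 0, 25856] (
  .branch 52 [105912113, 0, 0, 30288, 0, 30240, 0, 30240, 90453777, 0, 0, 30288, 0, 30272, 0, 30272,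
    0, 0, 18108260616, 30288, 0, 0, 0, 0, 0, 30240] (
   .leaf [⟨72, 2, 2, 0, [34608, 0, 0, 0, 34656, 0, 0, 0, 34608, 34608, 0, 34656]⟩,
     ⟨40, 1, 1, 0, [34608, 0, 0, 0, 0, 0, 0, 0, 0, 73537649, 0, 34608, 34608, 86827739142]⟩,
     ⟨20, 0, 0, 0, [34592, 34592, 0, 19198779656, 34624, 34624]⟩,
     ⟨52, 0, 0, 0, [34592, 0, 34640, 34624, 34624]⟩,
     ⟨66, 2, 2, 0, [34576, 0, 0, 0, 34576, 34576, 0, 34656]⟩,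
     ⟨34, 0, 0, 0, [34576, 34576, 34576]⟩,
     ⟨18, 0, 0, 0, [34576, 34576]⟩,
     ⟨50, 0, 0, 0, [34576]⟩,
     ⟨10, 2, 2, 0, [34576, 34576, 0, 18111406344]⟩,
     ⟨74, 2, 2, 0, [34576, 0, 34656]⟩,
     ⟨1, 1, 1, 0, [34560, 0, 34560, 34560, 34560]⟩,
     ⟨65, 2, 2, 0, [34560]⟩,
     ⟨9, 1, 1, 0, [34560, 34560, 34560]⟩,
     ⟨73, 1, 1, 0, [34560, 34560]⟩,
     ⟨5, 1, 1, 0, [34560]⟩]) (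
  .leaf [⟨8, 2, 1, 34, [30256, 30256, 0, 0, 0, 0, 0, 30256, 30256, 134574881, 30256, 136529745]⟩,
    ⟨40, 2, 2, 0, [30256, 0, 0, 30288, 0, 0, 30256, 30256]⟩,
    ⟨20, 0, 0, 0, [30240, 123876609, 0, 30272, 30272]⟩,
    ⟨2, 0, 0, 0, [30224, 0, 30224, 30224]⟩,
    ⟨34, 2, 2, 0, [30224, 0, 0, 30224, 30224]⟩,
    ⟨18, 0, 0, 0, [30224, 30224]⟩,
    ⟨50, 0, 0, 0, [30224]⟩,
    ⟨10, 2, 2, 0, [30224, 30224]⟩,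
    ⟨42, 2, 2, 0, [30224]⟩,
    ⟨1, 1, 1, 0, [30208, 30208, 30208]⟩,
    ⟨9, 1, 1, 0, [30208, 30208]⟩,
    ⟨5, 1, 1, 0, [30208]⟩])) (
 .leaf [⟨8, 0, 0, 0, [25904, 0, 0, 0, 25904, 25904]⟩,
   ⟨20, 1, 1, 0, [25888, 0, 0, 0, 0, 25888]⟩,
   ⟨2, 2, 2, 0, [25872, 25872]⟩,
   ⟨18, 2, 2, 0, [25872]⟩,
   ⟨10, 0, 0, 0, [25872, 25904]⟩,
   ⟨9, 0, 0, 0, [25856]⟩,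
   ⟨5, 1, 1, 0, [25856]⟩]))))

def path5Graph : List ℕ := [0, 1, 2, 4, 8]

def path5Rows : List (List ℕ) := [
  [],
  [0, 0, 0, 8448],
  [0, 0, 0, 12816],
  [0, 0, 0, 17184, 0, 0, 0, 4399369, 0, 17184],
  [0, 0, 0, 21552, 0, 0, 0, 5517849, 0, 21552]]

def path5Tree : Refutation :=
 .leaf [⟨0, 2, 2, 0, [52495953, 0, 0, 0, 0, 0, 0, 90182705]⟩,
   ⟨16, 1, 1, 0, [25920, 0, 106180865, 25920, 0, 0, 0, 25920, 6636329, 25920]⟩,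
   ⟨8, 0, 0, 0, [25904, 0, 0, 6631961, 25904]⟩,
   ⟨4, 1, 1, 0, [25888, 25888, 0, 0, 0, 6627593, 25888, 25888]⟩,
   ⟨20, 1, 1, 0, [25888, 0, 0, 0, 25920, 25888, 25888]⟩,
   ⟨2, 0, 0, 0, [25872, 25872]⟩,
   ⟨10, 0, 0, 0, [25872]⟩,
   ⟨1, 2, 2, 0, [25856]⟩,
   ⟨17, 1, 1, 0, [25856, 25856, 25856]⟩,
   ⟨5, 1, 1, 0, [25856, 25856]⟩,
   ⟨21, 1, 1, 0, [25856]⟩]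

def twoEdgesGraph : List ℕ := [0, 1, 0, 4]

def twoEdgesRows : List (List ℕ) := [
  [],
  [0, 0, 0, 8448],
  [],
  [0, 0, 0, 17184, 0, 2310410, 3293450, 17184, 0, 2310170, 3293210, 17184]]

def twoEdgesTree : Refutation :=
 .leaf [⟨0, 0, 0, 0, [88285445, 72556801, 0, 72418081]⟩,
   ⟨8, 0, 0, 0, [21552, 0, 3428618]⟩,
   ⟨4, 1, 1, 0, [21536, 0, 3294474]⟩,
   ⟨2, 0, 0, 0, [21520]⟩,
   ⟨1, 1, 1, 0, [21504]⟩]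

def edgeGraph : List ℕ := [0, 1]

def edgeRows : List (List ℕ) := [
  [],
  [0, 0, 0, 8448]]

def edgeTree : Refutation :=
 .leaf [⟨0, 0, 0, 0, [205067]⟩,
   ⟨2, 1, 1, 0, [12816]⟩,
   ⟨1, 2, 2, 0, [12800]⟩]

/-- A triangle, `P2 ∪ P4` and the Grötzsch graph. -/
def basePatterns : List (List ℕ) :=
  [[0, 1, 3], [0, 1, 0, 4, 8, 16], [0, 1, 1, 1, 1, 1, 18, 100, 138, 276, 616]]

theorem linkedSpiders_check : linkedSpidersTree.check (basePatterns) linkedSpidersGraph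
    (traces (basePatterns) [] linkedSpidersGraph [0] linkedSpidersRows) = true := by
  decide +kernel

theorem spider_check : spiderTree.check (basePatterns ++ [linkedSpidersGraph]) spiderGraph
    (traces (basePatterns ++ [linkedSpidersGraph]) [] spiderGraph [0] spiderRows) = true := by
  decide +kernel

theorem threeEdges_check : threeEdgesTree.check (basePatterns ++ [linkedSpidersGraph, spiderGraph])
    threeEdgesGraph
    (traces (basePatterns ++ [linkedSpidersGraph, spiderGraph]) [] threeEdgesGraph [0]
      threeEdgesRows) = true := by
  decide +kernel

theorem wagnerPlus_check : wagnerPlusTree.check (basePatterns ++ [linkedSpidersGraph, spiderGraph,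
    threeEdgesGraph]) wagnerPlusGraph
    (traces (basePatterns ++ [linkedSpidersGraph, spiderGraph, threeEdgesGraph]) [] wagnerPlusGraph
      [0] wagnerPlusRows) = true := by
  decide +kernel

theorem wagnerPair_check : wagnerPairTree.check (basePatterns ++ [linkedSpidersGraph, spiderGraph,
    threeEdgesGraph, wagnerPlusGraph]) wagnerPairGraph
    (traces (basePatterns ++ [linkedSpidersGraph, spiderGraph, threeEdgesGraph, wagnerPlusGraph]) []
      wagnerPairGraph [0] wagnerPairRows) = true := by
  decide +kernel

theorem wagner_check : wagnerTree.check (basePatterns ++ [linkedSpidersGraph, spiderGraph,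
    threeEdgesGraph, wagnerPlusGraph, wagnerPairGraph]) wagnerGraph
    (traces (basePatterns ++ [linkedSpidersGraph, spiderGraph, threeEdgesGraph, wagnerPlusGraph,
      wagnerPairGraph]) [] wagnerGraph [0] wagnerRows) = true := by
  decide +kernel

theorem cycle5_check : cycle5Tree.check (basePatterns ++ [linkedSpidersGraph, spiderGraph,
    threeEdgesGraph, wagnerPlusGraph, wagnerPairGraph, wagnerGraph]) cycle5Graph
    (traces (basePatterns ++ [linkedSpidersGraph, spiderGraph, threeEdgesGraph, wagnerPlusGraph,
      wagnerPairGraph, wagnerGraph]) [] cycle5Graph [0] cycle5Rows) = true := by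
  decide +kernel

theorem path5_check : path5Tree.check (basePatterns ++ [linkedSpidersGraph, spiderGraph,
    threeEdgesGraph, wagnerPlusGraph, wagnerPairGraph, wagnerGraph, cycle5Graph]) path5Graph
    (traces (basePatterns ++ [linkedSpidersGraph, spiderGraph, threeEdgesGraph, wagnerPlusGraph,
      wagnerPairGraph, wagnerGraph, cycle5Graph]) [] path5Graph [0] path5Rows) = true := by
  decide +kernel

theorem twoEdges_check : twoEdgesTree.check (basePatterns ++ [linkedSpidersGraph, spiderGraph,
    threeEdgesGraph, wagnerPlusGraph, wagnerPairGraph, wagnerGraph, cycle5Graph, path5Graph])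
    twoEdgesGraph
    (traces (basePatterns ++ [linkedSpidersGraph, spiderGraph, threeEdgesGraph, wagnerPlusGraph,
      wagnerPairGraph, wagnerGraph, cycle5Graph, path5Graph]) [] twoEdgesGraph [0] twoEdgesRows) =
      true := by
  decide +kernel

theorem edge_check : edgeTree.check (basePatterns ++ [linkedSpidersGraph, spiderGraph,
    threeEdgesGraph, wagnerPlusGraph, wagnerPairGraph, wagnerGraph, cycle5Graph, path5Graph,
    twoEdgesGraph]) edgeGraph
    (traces (basePatterns ++ [linkedSpidersGraph, spiderGraph, threeEdgesGraph, wagnerPlusGraph,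
      wagnerPairGraph, wagnerGraph, cycle5Graph, path5Graph, twoEdgesGraph]) [] edgeGraph [0]
      edgeRows) = true := by
  decide +kernel

end InducedSearch

namespace InducedSearch

theorem Occurs.containsInduced {V : Type*} {G : SimpleGraph V} {A : List ℕ} (h : Occurs G A)
    {n : ℕ} (hn : A.length = n) {H : SimpleGraph (Fin n)}
    (hH : ∀ a b : Fin n, H.Adj a b ↔ adjAt A a b = true)
    (htwin : ∀ a b : Fin n, (∀ c : Fin n, adjAt A a c = adjAt A b c) → a = b) :
    ContainsInduced H G := by
  obtain ⟨φ, hφ⟩ := h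
  have hadj : ∀ a b : Fin n, G.Adj (φ a) (φ b) ↔ adjAt A a b = true := fun a b =>
    hφ.adj_iff (hn ▸ a.2) (hn ▸ b.2)
  refine ⟨⟨fun a => φ a, fun a b hab => htwin a b fun c => ?_⟩, fun a b => ?_⟩
  · rw [Bool.eq_iff_iff, ← hadj, ← hadj]
    simp only at hab
    rw [hab]
  · exact (hadj a b).trans (hH a b).symm

theorem not_occurs_of_mem_basePatterns {V : Type*} {G : SimpleGraph V}
    (hG : ∀ x y z, G.Adj x y → G.Adj x z → ¬ G.Adj y z)
    (hP : ¬ ContainsInduced P2UnionP4 G) (hF : ¬ ContainsInduced GrotzschGraph G) :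
    ∀ P ∈ basePatterns, ¬ Occurs G P := by
  simp only [basePatterns, List.forall_mem_cons, List.not_mem_nil, false_implies, implies_true,
    and_true]
  refine ⟨?_, fun h => hP (h.containsInduced rfl ?_ (by decide)),
    fun h => hF (h.containsInduced rfl ?_ (by decide +kernel))⟩
  · rintro ⟨φ, hφ⟩
    refine hG (φ 0) (φ 1) (φ 2) ?_ ?_ ?_
    · exact (hφ 0 1 (by simp) (by simp)).2 (by decide)
    · exact (hφ 0 2 (by simp) (by simp)).2 (by decide)
    · exact (hφ 1 2 (by simp) (by simp)).2 (by decide)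
  · simp only [P2UnionP4, fromEdgeSet_adj, Set.mem_insert_iff, Set.mem_singleton_iff]
    decide +kernel
  · simp only [GrotzschGraph, fromEdgeSet_adj, Set.mem_insert_iff, Set.mem_singleton_iff]
    decide +kernel

end InducedSearch

open InducedSearch in
/-- A triangle-free graph all of whose endomorphisms are surjective is `3`-colourable, if it has
no induced `P2 ∪ P4` and no induced Grötzsch graph. -/
theorem colorable_three_of_surjective {V : Type*} {G : SimpleGraph V}
    (hG : ∀ x y z, G.Adj x y → G.Adj x z → ¬ G.Adj y z)
    (hP : ¬ ContainsInduced P2UnionP4 G) (hF : ¬ ContainsInduced GrotzschGraph G)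
    (hcrit : ∀ f : V → V, (∀ x y, G.Adj x y → G.Adj (f x) (f y)) → Function.Surjective f) :
    G.Colorable 3 := by
  by_contra hcol
  have step : ∀ {pats : List (List ℕ)} {A : List ℕ}, (∀ P ∈ pats, ¬ Occurs G P) →
      ¬ Occurs G A → ∀ P ∈ pats ++ [A], ¬ Occurs G P := fun h hA => by
    simp only [List.forall_mem_append, List.forall_mem_singleton]
    exact ⟨h, hA⟩
  have h0 := not_occurs_of_mem_basePatterns hG hP hF
  have h1 := step h0 (not_occurs_of_check h0 hG hcrit hcol _ linkedSpiders_check)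
  have h2 := step h1 (not_occurs_of_check h1 hG hcrit hcol _ spider_check)
  have h3 := step h2 (not_occurs_of_check h2 hG hcrit hcol _ threeEdges_check)
  have h4 := step h3 (not_occurs_of_check h3 hG hcrit hcol _ wagnerPlus_check)
  have h5 := step h4 (not_occurs_of_check h4 hG hcrit hcol _ wagnerPair_check)
  have h6 := step h5 (not_occurs_of_check h5 hG hcrit hcol _ wagner_check)
  have h7 := step h6 (not_occurs_of_check h6 hG hcrit hcol _ cycle5_check)
  have h8 := step h7 (not_occurs_of_check h7 hG hcrit hcol _ path5_check)
  have h9 := step h8 (not_occurs_of_check h8 hG hcrit hcol _ twoEdges_check)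
  have h10 := not_occurs_of_check h9 hG hcrit hcol _ edge_check
  refine hcol ⟨Coloring.mk (fun _ => 0) fun {x y} hxy => (h10 ?_).elim⟩
  refine ⟨fun i => if i = 0 then x else y, fun i j hij hj => ?_⟩
  obtain rfl : j = 1 := by simp [edgeGraph] at hj; omega
  obtain rfl : i = 0 := by omega
  simp [edgeGraph, hxy]

theorem ContainsInduced.of_induce {V α : Type*} {G : SimpleGraph V} {H : SimpleGraph α}
    {s : Set V} (h : ContainsInduced H (G.induce s)) : ContainsInduced H G := by
  obtain ⟨f, hf⟩ := h
  exact ⟨f.trans (Function.Embedding.subtype _), hf⟩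

theorem colorable_three_of_triangleFree {V : Type*} [Finite V] {G : SimpleGraph V}
    (hG : ∀ x y z, G.Adj x y → G.Adj x z → ¬ G.Adj y z)
    (hP : ¬ ContainsInduced P2UnionP4 G) (hF : ¬ ContainsInduced GrotzschGraph G) :
    G.Colorable 3 := by
  induction h : Nat.card V using Nat.strong_induction_on generalizing V with
  | _ n ih =>
    subst h
    refine by_contra fun hcol => hcol (colorable_three_of_surjective hG hP hF fun f hf => ?_)
    by_contra hsurj
    obtain ⟨z, hz⟩ := not_forall.1 hsurj
    have hz' : ∀ x, f x ∈ ({z}ᶜ : Set V) := fun x hx => hz ⟨x, hx⟩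
    obtain ⟨C⟩ := ih (Nat.card ({z}ᶜ : Set V))
      (Finite.card_subtype_lt (p := (· ∈ ({z}ᶜ : Set V))) (x := z) (by simp))
      (G := G.induce {z}ᶜ) (fun x y w => hG x y w) (fun h => hP h.of_induce)
      (fun h => hF h.of_induce) rfl
    exact hcol ⟨Coloring.mk (fun x => C ⟨f x, hz' x⟩) fun {x y} hxy =>
      C.valid (show G.Adj (f x) (f y) from hf x y hxy)⟩

/-! ### Maximal cliques, stable transversals, homogeneous sets -/

section Transversals

variable {V : Type*} (G : SimpleGraph V)

/-- `Q` is a nonempty maximal clique of the subgraph induced on `Y`. -/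
structure IsMaxCliqueIn (Y Q : Set V) : Prop where
  subset : Q ⊆ Y
  nonempty : Q.Nonempty
  isClique : G.IsClique Q
  mem : ∀ z ∈ Y, (∀ q ∈ Q, z ≠ q → G.Adj z q) → z ∈ Q

/-- `A` meets all maximal cliques of the subgraph induced on `Y`. -/
def Meets (Y A : Set V) : Prop :=
  ∀ Q, IsMaxCliqueIn G Y Q → ∃ a ∈ A, a ∈ Q

/-- The subgraph induced on `Y` has a stable set meeting all maximal cliques. -/
def HasStableTransversal (Y : Set V) : Prop :=
  ∃ T ⊆ Y, (∀ a ∈ T, ∀ b ∈ T, ¬ G.Adj a b) ∧ Meets G Y T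

/-- All induced subgraphs of `G[A]` have a stable transversal, that is, `G[A]` is strongly
perfect. -/
def IsStronglyPerfect (A : Set V) : Prop :=
  ∀ Z ⊆ A, HasStableTransversal G Z

/-- The maximal cliques of `G[Y]` are met by a set inducing a strongly perfect graph. -/
def HasPerfectTransversal (Y : Set V) : Prop :=
  ∃ A ⊆ Y, IsStronglyPerfect G A ∧ Meets G Y A

/-- `G[Y]` has no proper homogeneous set. -/
def IsPrimeOn (Y : Set V) : Prop :=
  ∀ X ⊆ Y, X.Nontrivial → (∀ y ∈ Y, y ∉ X → ∀ a ∈ X, ∀ b ∈ X, G.Adj y a → G.Adj y b) → Y ⊆ X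

/-- `G[H]` is a split graph. -/
def IsSplitOn (H : Set V) : Prop :=
  ∃ R S, H ⊆ R ∪ S ∧ G.IsClique R ∧ ∀ a ∈ S, ∀ b ∈ S, ¬ G.Adj a b

variable {G}

theorem Meets.substitute {Y X A' B : Set V} {x : V} (hXY : X ⊆ Y) (hX : X.Nonempty)
    (hx : x ∉ Y \ X) (hhom : ∀ y ∈ Y, y ∉ X → ∀ a ∈ X, G.Adj y a ↔ G.Adj y x)
    (hA : Meets G (insert x (Y \ X)) A') (hB : Meets G X B) :
    Meets G Y {y | (y ∉ X ∧ y ∈ A') ∨ (y ∈ X ∧ x ∈ A' ∧ y ∈ B)} := by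
  intro Q hQ
  by_cases hQX : (Q ∩ X).Nonempty
  · obtain ⟨p, hpQ, hpX⟩ := hQX
    have hadj : ∀ w ∈ Q, w ∉ X → ∀ a ∈ X, G.Adj w a := fun w hw hwX a ha => by
      rw [hhom w (hQ.subset hw) hwX a ha, ← hhom w (hQ.subset hw) hwX p hpX]
      exact hQ.isClique hw hpQ fun h => hwX (h ▸ hpX)
    have hadjx : ∀ w ∈ Q, w ∉ X → G.Adj w x := fun w hw hwX =>
      (hhom w (hQ.subset hw) hwX p hpX).1 (hadj w hw hwX p hpX)
    obtain ⟨a, haA, ha⟩ := hA (insert x (Q \ X)) {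
      subset := Set.insert_subset_insert (Set.sdiff_subset_sdiff_left hQ.subset)
      nonempty := Set.insert_nonempty _ _
      isClique := by
        rw [isClique_insert]
        exact ⟨hQ.isClique.subset Set.sdiff_subset, fun b hb _ => (hadjx b hb.1 hb.2).symm⟩
      mem := by
        rintro z (rfl | ⟨hzY, hzX⟩) hz
        · exact Set.mem_insert _ _
        · refine Set.mem_insert_of_mem _ ⟨hQ.mem z hzY fun q hq hzq => ?_, hzX⟩
          by_cases hqX : q ∈ X
          · rw [hhom z hzY hzX q hqX]
            exact hz x (Set.mem_insert _ _) fun h => hx ⟨h ▸ hzY, h ▸ hzX⟩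
          · exact hz q (Set.mem_insert_of_mem _ ⟨hq, hqX⟩) hzq }
    rcases ha with rfl | ha
    · obtain ⟨b, hb, hbQ⟩ := hB (Q ∩ X) {
        subset := Set.inter_subset_right
        nonempty := ⟨p, hpQ, hpX⟩
        isClique := hQ.isClique.subset Set.inter_subset_left
        mem := fun z hzX hz => ⟨hQ.mem z (hXY hzX) fun q hq hzq => by
          by_cases hqX : q ∈ X
          · exact hz q ⟨hq, hqX⟩ hzq
          · exact (hadj q hq hqX z hzX).symm, hzX⟩ }
      exact ⟨b, .inr ⟨hbQ.2, haA, hb⟩, hbQ.1⟩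
    · exact ⟨a, .inl ⟨ha.2, haA⟩, ha.1⟩
  · have hQX : ∀ q ∈ Q, q ∉ X := fun q hq hqX => hQX ⟨q, hq, hqX⟩
    obtain ⟨a, haA, ha⟩ := hA Q {
      subset := fun q hq => .inr ⟨hQ.subset hq, hQX q hq⟩
      nonempty := hQ.nonempty
      isClique := hQ.isClique
      mem := by
        rintro z (rfl | ⟨hzY, hzX⟩) hz
        · obtain ⟨p, hp⟩ := hX
          refine absurd hp (hQX p (hQ.mem p (hXY hp) fun q hq hpq => ?_))
          refine ((hhom q (hQ.subset hq) (hQX q hq) p hp).2 (hz q hq ?_).symm).symm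
          rintro rfl
          exact hx ⟨hQ.subset hq, hQX _ hq⟩
        · exact hQ.mem z hzY hz }
    exact ⟨a, .inl ⟨hQX a ha, haA⟩, ha⟩

theorem HasStableTransversal.substitute {Y X : Set V} {x : V} (hXY : X ⊆ Y) (hX : X.Nonempty)
    (hx : x ∉ Y \ X) (hhom : ∀ y ∈ Y, y ∉ X → ∀ a ∈ X, G.Adj y a ↔ G.Adj y x)
    (h : HasStableTransversal G (insert x (Y \ X))) (h' : HasStableTransversal G X) :
    HasStableTransversal G Y := by
  obtain ⟨T, -, hst, hm⟩ := h
  obtain ⟨T', -, hst', hm'⟩ := h'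
  refine ⟨{y | y ∈ Y ∧ ((y ∉ X ∧ y ∈ T) ∨ (y ∈ X ∧ x ∈ T ∧ y ∈ T'))}, fun y hy => hy.1, ?_,
    fun Q hQ => ?_⟩
  · rintro a ⟨haY, ⟨haX, ha⟩ | ⟨haX, hxT, ha⟩⟩ b ⟨hbY, ⟨hbX, hb⟩ | ⟨hbX, hxT, hb⟩⟩ hab
    · exact hst a ha b hb hab
    · exact hst a ha x hxT ((hhom a haY haX b hbX).1 hab)
    · exact hst b hb x hxT ((hhom b hbY hbX a haX).1 hab.symm)
    · exact hst' a ha b hb hab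
  · obtain ⟨a, ha, haQ⟩ := hm.substitute hXY hX hx hhom hm' Q hQ
    exact ⟨a, ⟨hQ.subset haQ, ha⟩, haQ⟩

theorem HasPerfectTransversal.substitute {Y X : Set V} {x : V} (hXY : X ⊆ Y) (hxX : x ∈ X)
    (hhom : ∀ y ∈ Y, y ∉ X → ∀ a ∈ X, G.Adj y a ↔ G.Adj y x)
    (h : HasPerfectTransversal G (insert x (Y \ X))) (h' : HasPerfectTransversal G X) :
    HasPerfectTransversal G Y := by
  obtain ⟨A, -, hsp, hm⟩ := h
  obtain ⟨B, -, hsp', hm'⟩ := h'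
  refine ⟨{y | y ∈ Y ∧ ((y ∉ X ∧ y ∈ A) ∨ (y ∈ X ∧ x ∈ A ∧ y ∈ B))}, fun y hy => hy.1,
    fun Z hZ => ?_, fun Q hQ => ?_⟩
  · by_cases hne : (Z ∩ X).Nonempty
    · have hxA : x ∈ A := by
        obtain ⟨p, hp, hpX⟩ := hne
        rcases (hZ hp).2 with h | h
        · exact absurd hpX h.1
        · exact h.2.1
      refine HasStableTransversal.substitute (X := Z ∩ X) (x := x) Set.inter_subset_left hne
        (fun h => h.2 ⟨h.1, hxX⟩) (fun y hy hyX a ha => hhom y (hZ hy).1 (fun h => hyX ⟨hy, h⟩)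
          a ha.2) (hsp _ ?_) (hsp' _ ?_)
      · rintro z (rfl | ⟨hz, hzX⟩)
        · exact hxA
        · rcases (hZ hz).2 with h | h
          · exact h.2
          · exact absurd ⟨hz, h.1⟩ hzX
      · rintro z ⟨hz, hzX⟩
        rcases (hZ hz).2 with h | h
        · exact absurd hzX h.1
        · exact h.2.2
    · refine hsp Z fun z hz => ?_
      rcases (hZ hz).2 with h | h
      · exact h.2
      · exact absurd ⟨z, hz, h.1⟩ hne
  · obtain ⟨a, ha, haQ⟩ := hm.substitute hXY ⟨x, hxX⟩ (fun h => h.2 hxX) hhom hm' Q hQ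
    exact ⟨a, ⟨hQ.subset haQ, ha⟩, haQ⟩

/-- A property of vertex sets that is preserved by substitution holds as soon as it holds for
all prime sets. -/
theorem forall_subset_of_isPrimeOn [Finite V] {p : Set V → Prop} {A : Set V}
    (hsub : ∀ Y X x, X ⊆ Y → x ∈ X → (∀ y ∈ Y, y ∉ X → ∀ a ∈ X, G.Adj y a ↔ G.Adj y x) →
      p (insert x (Y \ X)) → p X → p Y)
    (hprime : ∀ Y ⊆ A, IsPrimeOn G Y → p Y) : ∀ Y ⊆ A, p Y := by
  intro Y
  induction Y using WellFoundedLT.induction with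
  | ind Y ih =>
    intro hYA
    by_cases hY : IsPrimeOn G Y
    · exact hprime Y hYA hY
    simp only [IsPrimeOn, not_forall] at hY
    obtain ⟨X, hXY, ⟨x, hx, x', hx', hne⟩, hhom, hYX⟩ := hY
    have hlt : insert x (Y \ X) ⊂ Y := by
      refine ⟨Set.insert_subset (hXY hx) Set.sdiff_subset, fun h => ?_⟩
      rcases h (hXY hx') with h | h
      · exact hne h.symm
      · exact h.2 hx'
    exact hsub Y X x hXY hx (fun y hy hyX a ha => ⟨hhom y hy hyX a ha x hx, hhom y hy hyX x hx a
        ha⟩)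
      (ih _ hlt (hlt.1.trans hYA)) (ih X ⟨hXY, hYX⟩ (hXY.trans hYA))

theorem isStronglyPerfect_of_isPrimeOn [Finite V] {A : Set V}
    (h : ∀ Y ⊆ A, IsPrimeOn G Y → HasStableTransversal G Y) : IsStronglyPerfect G A :=
  forall_subset_of_isPrimeOn (fun _ _ _ hXY hx hhom h h' =>
    h.substitute hXY ⟨_, hx⟩ (fun h => h.2 hx) hhom h') h

theorem hasPerfectTransversal_of_isPrimeOn [Finite V]
    (h : ∀ Y, IsPrimeOn G Y → HasPerfectTransversal G Y) (Y : Set V) :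
    HasPerfectTransversal G Y :=
  forall_subset_of_isPrimeOn (A := Set.univ) (fun _ _ _ hXY hx hhom h h' =>
    h.substitute hXY hx hhom h') (fun Y _ => h Y) Y (Set.subset_univ _)

theorem IsSplitOn.hasStableTransversal {H : Set V} (h : IsSplitOn G H) :
    HasStableTransversal G H := by
  obtain ⟨R, S, hRS, hR, hS⟩ := h
  by_cases hr : ∃ r ∈ H, r ∈ R
  · obtain ⟨r, hrH, hrR⟩ := hr
    refine ⟨{y | y ∈ H ∧ (y = r ∨ (y ∈ S ∧ ¬ G.Adj y r))}, fun y hy => hy.1, ?_, fun Q hQ => ?_⟩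
    · rintro a ⟨-, rfl | ⟨haS, ha⟩⟩ b ⟨-, rfl | ⟨hbS, hb⟩⟩ hab
      · exact G.irrefl hab
      · exact hb hab.symm
      · exact ha hab
      · exact hS a haS b hbS hab
    · by_contra! hcon
      have hadj : ∀ q ∈ Q, G.Adj r q := by
        intro q hq
        by_contra hrq
        refine hcon q ⟨hQ.subset hq, ?_⟩ hq
        rcases hRS (hQ.subset hq) with h | h
        · refine .inl (by_contra fun hne => hrq (hR hrR h (Ne.symm hne)))
        · exact .inr ⟨h, fun h => hrq h.symm⟩
      exact hcon r ⟨hrH, .inl rfl⟩ (hQ.mem r hrH fun q hq _ => hadj q hq)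
  · refine ⟨H, subset_rfl, fun a ha b hb => hS a ?_ b ?_, fun Q hQ => ?_⟩
    · exact (hRS ha).resolve_left fun h => hr ⟨a, ha, h⟩
    · exact (hRS hb).resolve_left fun h => hr ⟨b, hb, h⟩
    · obtain ⟨q, hq⟩ := hQ.nonempty
      exact ⟨q, hQ.subset hq, hq⟩

theorem Meets.ncard_diff_le [Finite V] {Y A : Set V} (hA : Meets G Y A) {k : ℕ}
    (hk : ∀ Q ⊆ Y, G.IsClique Q → Q.ncard ≤ k + 1) :
    ∀ Q ⊆ Y \ A, G.IsClique Q → Q.ncard ≤ k := by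
  intro Q hQ hcl
  by_contra! hlt
  obtain ⟨a, haA, haQ⟩ := hA Q {
    subset := fun q hq => (hQ hq).1
    nonempty := Set.nonempty_of_ncard_ne_zero (by omega)
    isClique := hcl
    mem := fun z hzY hz => by
      by_contra hzQ
      have := hk (insert z Q) (Set.insert_subset hzY fun q hq => (hQ hq).1)
        (isClique_insert.2 ⟨hcl, fun b hb hne => hz b hb hne⟩)
      rw [Set.ncard_insert_of_notMem hzQ] at this
      omega }
  exact (hQ haQ).2 haA

theorem IsStronglyPerfect.exists_coloring [Finite V] {k : ℕ} : ∀ {A : Set V},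
    IsStronglyPerfect G A → (∀ Q ⊆ A, G.IsClique Q → Q.ncard ≤ k) →
      ∃ f : V → ℕ, (∀ a ∈ A, f a < k) ∧ ∀ a ∈ A, ∀ b ∈ A, G.Adj a b → f a ≠ f b := by
  classical
  induction k with
  | zero =>
    intro A _ hk
    have hA : ∀ a, a ∉ A := fun a ha => by
      have := hk {a} (by simpa using ha) (by simp)
      simp at this
    exact ⟨fun _ => 0, fun a ha => absurd ha (hA a), fun a ha => absurd ha (hA a)⟩
  | succ k ih =>
    intro A hA hk
    obtain ⟨T, hTA, hst, hT⟩ := hA A subset_rfl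
    obtain ⟨f, hf, hf'⟩ := ih (fun Z hZ => hA Z (hZ.trans Set.sdiff_subset)) (hT.ncard_diff_le hk)
    refine ⟨fun a => if a ∈ T then k else f a, fun a ha => ?_, fun a ha b hb hab => ?_⟩
    · simp only
      split_ifs with h
      · omega
      · exact (hf a ⟨ha, h⟩).trans (Nat.lt_succ_self k)
    · simp only
      split_ifs with h1 h2 h2
      · exact absurd hab (hst a h1 b h2)
      · exact (hf b ⟨hb, h2⟩).ne'
      · exact (hf a ⟨ha, h1⟩).ne
      · exact hf' a ⟨ha, h1⟩ b ⟨hb, h2⟩ hab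

theorem exists_coloring_of_hasPerfectTransversal [Finite V]
    (h : ∀ Y, HasPerfectTransversal G Y) (k : ℕ) : ∀ (Y : Set V),
    (∀ Q ⊆ Y, G.IsClique Q → Q.ncard ≤ k) →
      ∃ f : V → ℕ, (∀ a ∈ Y, f a < k * (k + 1) / 2) ∧
        ∀ a ∈ Y, ∀ b ∈ Y, G.Adj a b → f a ≠ f b := by
  classical
  induction k with
  | zero =>
    intro A hk
    have hA : ∀ a, a ∉ A := fun a ha => by
      have := hk {a} (by simpa using ha) (by simp)
      simp at this
    exact ⟨fun _ => 0, fun a ha => absurd ha (hA a), fun a ha => absurd ha (hA a)⟩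
  | succ k ih =>
    intro Y hk
    obtain ⟨A, hAY, hA, hm⟩ := h Y
    obtain ⟨f, hf, hf'⟩ := hA.exists_coloring fun Q hQ => hk Q (hQ.trans hAY)
    obtain ⟨g, hg, hg'⟩ := ih (Y \ A) (hm.ncard_diff_le hk)
    have hsum : (k + 1) * (k + 1 + 1) / 2 = k * (k + 1) / 2 + (k + 1) := by
      rw [show (k + 1) * (k + 1 + 1) = k * (k + 1) + (k + 1) * 2 by ring,
        Nat.add_mul_div_right _ _ two_pos]
    refine ⟨fun a => if a ∈ A then k * (k + 1) / 2 + f a else g a, fun a ha => ?_,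
      fun a ha b hb hab => ?_⟩
    · simp only [hsum]
      split_ifs with h
      · exact Nat.add_lt_add_left (hf a h) _
      · exact (hg a ⟨ha, h⟩).trans_le (Nat.le_add_right _ _)
    · simp only
      split_ifs with h1 h2 h2
      · simpa using hf' a h1 b h2 hab
      · have := hg b ⟨hb, h2⟩
        omega
      · have := hg a ⟨ha, h1⟩
        omega
      · exact hg' a ⟨ha, h1⟩ b ⟨hb, h2⟩ hab

theorem chromaticNumber_le_of_hasPerfectTransversal [Fintype V]
    (h : ∀ Y, HasPerfectTransversal G Y) :
    G.chromaticNumber ≤ ((G.cliqueNum * (G.cliqueNum + 1) / 2 : ℕ) : ℕ∞) := by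
  classical
  obtain ⟨f, hf, hf'⟩ := exists_coloring_of_hasPerfectTransversal h G.cliqueNum Set.univ
    fun Q _ hQ => by
      rw [Set.ncard_eq_toFinset_card']
      exact IsClique.card_le_cliqueNum (tc := by simpa using hQ)
  rw [chromaticNumber_le_iff_colorable]
  exact ⟨Coloring.mk (fun x => ⟨f x, hf x trivial⟩) fun {x y} hxy => by
    simpa [Fin.ext_iff] using hf' x trivial y trivial hxy⟩

theorem hasPerfectTransversal_of_coloring {Y : Set V} (hY : (G.induce Y).Colorable 3) :
    HasPerfectTransversal G Y := by
  classical
  obtain ⟨C⟩ := hY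
  obtain ⟨f, hf⟩ : ∃ f : V → Fin 3, ∀ a ∈ Y, ∀ b ∈ Y, G.Adj a b → f a ≠ f b :=
    ⟨fun x => if hx : x ∈ Y then C ⟨x, hx⟩ else 0, fun a ha b hb hab => by
      simp only [ha, hb, dif_pos]
      exact C.valid hab⟩
  refine ⟨{y | y ∈ Y ∧ (f y ≠ 2 ∨ ∀ w ∈ Y, ¬ G.Adj y w)}, fun y hy => hy.1, fun Z hZ => ?_,
    fun Q hQ => ?_⟩
  · refine ⟨{z | z ∈ Z ∧ (f z = 0 ∨ ∀ w ∈ Z, ¬ G.Adj z w)}, fun z hz => hz.1, ?_, fun Q hQ => ?_⟩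
    · rintro a ⟨ha, h1⟩ b ⟨hb, h2⟩ hab
      rcases h1 with h1 | h1
      · rcases h2 with h2 | h2
        · exact hf a (hZ ha).1 b (hZ hb).1 hab (h1.trans h2.symm)
        · exact h2 a ha hab.symm
      · exact h1 b hb hab
    · by_contra! hcon
      obtain ⟨q, hq⟩ := hQ.nonempty
      have key : ∀ a ∈ Q, f a = 1 ∧ ∃ w ∈ Z, G.Adj a w := fun a ha => by
        have h1 := hcon a
        simp only [Set.mem_ofPred_eq, hQ.subset ha, true_and] at h1
        have h2 : ¬ (f a = 0 ∨ ∀ w ∈ Z, ¬ G.Adj a w) := fun h => h1 h ha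
        push Not at h2
        obtain ⟨h3, w, hw, haw⟩ := h2
        have h4 : f a ≠ 2 := (hZ (hQ.subset ha)).2.resolve_right fun h => h w (hZ hw).1 haw
        exact ⟨by omega, w, hw, haw⟩
      obtain ⟨hq1, w, hw, hqw⟩ := key q hq
      have hwQ : w ∈ Q := hQ.mem w hw fun a ha hne => by
        obtain rfl | hqa := eq_or_ne q a
        · exact hqw.symm
        · exact absurd (hq1.trans (key a ha).1.symm) (hf q (hZ (hQ.subset hq)).1 a
            (hZ (hQ.subset ha)).1 (hQ.isClique hq ha hqa))
      exact hf q (hZ (hQ.subset hq)).1 w (hZ hw).1 hqw (hq1.trans (key w hwQ).1.symm)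
  · by_contra! hcon
    obtain ⟨q, hq⟩ := hQ.nonempty
    have key : ∀ a ∈ Q, f a = 2 ∧ ∃ w ∈ Y, G.Adj a w := fun a ha => by
      have h2 : ¬ (f a ≠ 2 ∨ ∀ w ∈ Y, ¬ G.Adj a w) := fun h => hcon a ⟨hQ.subset ha, h⟩ ha
      push Not at h2
      exact h2
    obtain ⟨hq1, w, hw, hqw⟩ := key q hq
    have hwQ : w ∈ Q := hQ.mem w hw fun a ha hne => by
      obtain rfl | hqa := eq_or_ne q a
      · exact hqw.symm
      · exact absurd (hq1.trans (key a ha).1.symm) (hf q (hQ.subset hq) a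
          (hQ.subset ha) (hQ.isClique hq ha hqa))
    exact hf q (hQ.subset hq) w hw hqw (hq1.trans (key w hwQ).1.symm)

end Transversals

/-! ### Sets without induced four-vertex paths -/

section Cographs

variable {V : Type*} {G : SimpleGraph V}

/-- The subgraph induced on `R` contains no induced path on four vertices. -/
def NoP4On (G : SimpleGraph V) (R : Set V) : Prop :=
  ∀ a ∈ R, ∀ b ∈ R, ∀ c ∈ R, ∀ d ∈ R, G.Adj a b → G.Adj b c → G.Adj c d →
    ¬ G.Adj a c → ¬ G.Adj a d → ¬ G.Adj b d → False

/-- `R` is the disjoint union of two nonempty sets without edges between them. -/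
def IsDisconnectedOn (G : SimpleGraph V) (R : Set V) : Prop :=
  ∃ A B, A ∪ B = R ∧ Disjoint A B ∧ A.Nonempty ∧ B.Nonempty ∧ ∀ a ∈ A, ∀ b ∈ B, ¬ G.Adj a b

/-- If `x` has a neighbour in the component of `y` in `G[R]`, but is not adjacent to `y`, then
some edge of the component has exactly one end adjacent to `x`. -/
theorem exists_adj_of_reflTransGen {p : V → Prop} {x y z : V}
    (hyz : Relation.ReflTransGen (fun a b => G.Adj a b ∧ p b) y z) (hy : ¬ G.Adj x y)
    (hz : G.Adj x z) :
    ∃ k k', Relation.ReflTransGen (fun a b => G.Adj a b ∧ p b) y k ∧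
      Relation.ReflTransGen (fun a b => G.Adj a b ∧ p b) y k' ∧ G.Adj k k' ∧ G.Adj x k ∧
        ¬ G.Adj x k' := by
  induction hyz with
  | refl => exact absurd hz hy
  | @tail b c hb hbc ih =>
    by_cases hxb : G.Adj x b
    · exact ih hxb
    · exact ⟨c, b, hb.tail hbc, hb, hbc.1.symm, hz, hxb⟩

theorem mem_of_reflTransGen {R : Set V} {y z : V} (hy : y ∈ R)
    (h : Relation.ReflTransGen (fun a b => G.Adj a b ∧ b ∈ R) y z) : z ∈ R := by
  induction h with
  | refl => exact hy
  | tail _ h _ => exact h.2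

theorem NoP4On.compl {R : Set V} (h : NoP4On G R) : NoP4On Gᶜ R := by
  intro a ha b hb c hc d hd hab hbc hcd hac had hbd
  have hac' : a ≠ c := fun e => had (e ▸ hcd)
  have had' : a ≠ d := fun e => hac (e ▸ hcd.symm)
  have hbd' : b ≠ d := fun e => had (e ▸ hab)
  simp only [compl_adj, not_and, not_not] at hab hbc hcd hac had hbd
  exact h b hb d hd a ha c hc (hbd hbd') (had had').symm (hac hac') (fun e => hab.2 e.symm)
    hbc.2 fun e => hcd.2 e.symm

theorem NoP4On.mono {R R' : Set V} (h : NoP4On G R) (hR : R' ⊆ R) : NoP4On G R' :=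
  fun a ha b hb c hc d hd => h a (hR ha) b (hR hb) c (hR hc) d (hR hd)

theorem IsDisconnectedOn.exists_not_reflTransGen {R : Set V} (h : IsDisconnectedOn G R) {y : V}
    (hy : y ∈ R) : ∃ w ∈ R, ¬ Relation.ReflTransGen (fun a b => G.Adj a b ∧ b ∈ R) y w := by
  obtain ⟨A, B, rfl, hdisj, ⟨a, ha⟩, ⟨b, hb⟩, hAB⟩ := h
  rw [Set.disjoint_left] at hdisj
  have key : ∀ z, Relation.ReflTransGen (fun a b => G.Adj a b ∧ b ∈ A ∪ B) y z →
      (z ∈ A ↔ y ∈ A) := fun z hz => by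
    induction hz with
    | refl => rfl
    | @tail c d hc hcd ih =>
      rw [← ih]
      have hcR : c ∈ A ∪ B := mem_of_reflTransGen hy hc
      refine ⟨fun hd => hcR.resolve_right fun h => hAB d hd c h hcd.1.symm,
        fun hc => hcd.2.resolve_right fun h => hAB c hc d h hcd.1⟩
  by_cases hyA : y ∈ A
  · exact ⟨b, .inr hb, fun h => hdisj ((key b h).2 hyA) hb⟩
  · exact ⟨a, .inl ha, fun h => hyA ((key a h).1 ha)⟩

theorem isDisconnectedOn_insert {R : Set V} {x : V} (hx : x ∉ R) (hP : NoP4On G (insert x R))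
    (h : IsDisconnectedOn G R) :
    IsDisconnectedOn G (insert x R) ∨ IsDisconnectedOn Gᶜ (insert x R) := by
  by_cases hxR : ∀ y ∈ R, G.Adj x y
  · obtain ⟨A, B, rfl, -, ⟨a, ha⟩, -⟩ := h
    exact .inr ⟨{x}, A ∪ B, rfl, by simpa using hx, by simp, ⟨a, .inl ha⟩,
      fun y hy z hz => by simpa [Set.mem_singleton_iff.1 hy] using fun _ => hxR z hz⟩
  push Not at hxR
  obtain ⟨y, hyR, hxy⟩ := hxR
  let K : Set V := {z | Relation.ReflTransGen (fun a b => G.Adj a b ∧ b ∈ R) y z}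
  have hKR : K ⊆ R := fun z hz => mem_of_reflTransGen hyR hz
  have hyK : y ∈ K := Relation.ReflTransGen.refl
  have hK : ∀ k ∈ K, ∀ z ∈ R, z ∉ K → ¬ G.Adj k z := fun k hk z hz hzK hkz =>
    hzK (hk.tail ⟨hkz, hz⟩)
  have hxK : x ∉ K := fun h => hx (hKR h)
  by_cases hadj : ∃ z ∈ K, G.Adj x z
  · obtain ⟨z, hz, hxz⟩ := hadj
    obtain ⟨k, k', hk, hk', hkk', hxk, hxk'⟩ := exists_adj_of_reflTransGen hz hxy hxz
    have hout : ∀ w ∈ R, w ∉ K → ¬ G.Adj x w := fun w hw hwK hxw =>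
      hP w (.inr hw) x (.inl rfl) k (.inr (hKR hk)) k' (.inr (hKR hk')) hxw.symm hxk hkk'
        (fun e => hK k hk w hw hwK e.symm) (fun e => hK k' hk' w hw hwK e.symm) hxk'
    obtain ⟨w, hwR, hwK⟩ := h.exists_not_reflTransGen hyR
    refine .inl ⟨insert x K, R \ K, ?_, ?_, ⟨x, .inl rfl⟩, ⟨w, hwR, hwK⟩, ?_⟩
    · rw [Set.insert_union, Set.union_sdiff_cancel hKR]
    · rw [Set.disjoint_left]
      rintro z (rfl | hz) hz'
      exacts [hx hz'.1, hz'.2 hz]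
    · rintro a (rfl | ha) b hb
      exacts [hout b hb.1 hb.2, hK a ha b hb.1 hb.2]
  · push Not at hadj
    refine .inl ⟨K, insert x (R \ K), ?_, ?_, ⟨y, hyK⟩, ⟨x, .inl rfl⟩, ?_⟩
    · rw [Set.union_insert, Set.union_sdiff_cancel hKR]
    · rw [Set.disjoint_left]
      rintro z hz (rfl | hz')
      exacts [hxK hz, hz'.2 hz]
    · rintro a ha b (rfl | hb)
      exacts [fun h => hadj a ha h.symm, hK a ha b hb.1 hb.2]

theorem NoP4On.isDisconnectedOn [Finite V] {R : Set V} (hP : NoP4On G R) (hR : R.Nontrivial) :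
    IsDisconnectedOn G R ∨ IsDisconnectedOn Gᶜ R := by
  induction R, Set.toFinite R using Set.Finite.induction_on with
  | empty => exact absurd hR Set.not_nontrivial_empty
  | @insert x R hx _ ih =>
    have hPR := hP.mono (Set.subset_insert x R)
    by_cases hn : R.Nontrivial
    · rcases ih hPR hn with h | h
      · exact isDisconnectedOn_insert hx hP h
      · simpa [or_comm] using isDisconnectedOn_insert hx hP.compl h
    · obtain ⟨y, hy⟩ : R.Nonempty := by
        rw [Set.nonempty_iff_ne_empty]
        rintro rfl
        simp at hR
      have hxy : x ≠ y := fun h => hx (h ▸ hy)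
      obtain rfl : R = {y} := (Set.not_nontrivial_iff.1 hn).eq_singleton_of_mem hy
      by_cases hadj : G.Adj x y
      · exact .inr ⟨{x}, {y}, rfl, by simpa using hxy, by simp, by simp, by simp [hadj]⟩
      · exact .inl ⟨{x}, {y}, rfl, by simpa using hxy, by simp, by simp, by simp [hadj]⟩

/-- Let `S` be a set of vertices such that the neighbours in `R` of a member `s` of `S` extend to
components as soon as they contain an edge, and such that no induced path `s a b t` has its ends
in `S` and its interior in `R`. Then some stable subset of `R` without neighbours in `S` meets all
maximal cliques of `G[R]` that are not complete to a member of `S`. -/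
theorem NoP4On.exists_stable [Finite V] {R : Set V} (hP : NoP4On G R) (S : Set V)
    (htri : ∀ s ∈ S, ∀ k ∈ R, ∀ k' ∈ R, ∀ c ∈ R, G.Adj k k' → G.Adj s k → G.Adj s k' →
      G.Adj c k → ¬ G.Adj c k' → G.Adj s c)
    (hpath : ∀ s ∈ S, ∀ t ∈ S, ∀ a ∈ R, ∀ b ∈ R, G.Adj s a → G.Adj a b → G.Adj b t →
      ¬ G.Adj s b → G.Adj t a) :
    ∃ T ⊆ R, (∀ a ∈ T, ∀ b ∈ T, ¬ G.Adj a b) ∧ (∀ s ∈ S, ∀ a ∈ T, ¬ G.Adj s a) ∧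
      ∀ Q, IsMaxCliqueIn G R Q → (∃ a ∈ T, a ∈ Q) ∨ ∃ s ∈ S, ∀ q ∈ Q, G.Adj s q := by
  induction R using WellFoundedLT.induction generalizing S with
  | ind R ih =>
  by_cases hs : ∃ s ∈ S, ∀ q ∈ R, G.Adj s q
  · obtain ⟨s, hs, hsR⟩ := hs
    exact ⟨∅, by simp, by simp, by simp, fun Q hQ => .inr ⟨s, hs, fun q hq => hsR q (hQ.subset hq)⟩⟩
  push Not at hs
  by_cases hn : R.Nontrivial
  swap
  · rw [Set.not_nontrivial_iff] at hn
    refine ⟨R, subset_rfl, fun a ha b hb hab => hab.ne (hn ha hb), fun s hsS a ha hsa => ?_,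
      fun Q hQ => ?_⟩
    · obtain ⟨q, hq, hsq⟩ := hs s hsS
      exact hsq (hn ha hq ▸ hsa)
    · obtain ⟨q, hq⟩ := hQ.nonempty
      exact .inl ⟨q, hQ.subset hq, hq⟩
  rcases hP.isDisconnectedOn hn with ⟨A, B, rfl, hdisj, hA, hB, hAB⟩ | ⟨A, B, rfl, hdisj, hA, hB,
      hAB⟩
  · rw [Set.disjoint_left] at hdisj
    have hsub : ∀ J ⊂ A ∪ B, ∃ T ⊆ J, (∀ a ∈ T, ∀ b ∈ T, ¬ G.Adj a b) ∧
        (∀ s ∈ S, ∀ a ∈ T, ¬ G.Adj s a) ∧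
          ∀ Q, IsMaxCliqueIn G J Q → (∃ a ∈ T, a ∈ Q) ∨ ∃ s ∈ S, ∀ q ∈ Q, G.Adj s q :=
      fun J hJ => ih J hJ (hP.mono hJ.1) S
        (fun s hs k hk k' hk' c hc => htri s hs k (hJ.1 hk) k' (hJ.1 hk') c (hJ.1 hc))
        (fun s hs t ht a ha b hb => hpath s hs t ht a (hJ.1 ha) b (hJ.1 hb))
    obtain ⟨a₀, ha₀⟩ := hA
    obtain ⟨b₀, hb₀⟩ := hB
    obtain ⟨T, hTA, hT, hTS, hTQ⟩ := hsub A
      ⟨Set.subset_union_left, fun h => hdisj (h (.inr hb₀)) hb₀⟩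
    obtain ⟨T', hTB, hT', hTS', hTQ'⟩ := hsub B
      ⟨Set.subset_union_right, fun h => hdisj ha₀ (h (.inl ha₀))⟩
    refine ⟨T ∪ T', Set.union_subset_union hTA hTB, ?_, ?_, fun Q hQ => ?_⟩
    · rintro a (ha | ha) b (hb | hb) hab
      exacts [hT a ha b hb hab, hAB a (hTA ha) b (hTB hb) hab, hAB b (hTA hb) a (hTB ha) hab.symm,
        hT' a ha b hb hab]
    · rintro s hs a (ha | ha)
      exacts [hTS s hs a ha, hTS' s hs a ha]
    · obtain ⟨q, hq⟩ := hQ.nonempty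
      rcases hQ.subset hq with hqA | hqB
      · have hQA : Q ⊆ A := fun x hx => (hQ.subset hx).resolve_right fun hxB =>
          hAB q hqA x hxB (hQ.isClique hq hx fun h => hdisj (h ▸ hqA) hxB)
        refine (hTQ Q ⟨hQA, ⟨q, hq⟩, hQ.isClique, fun z hz => hQ.mem z (.inl hz)⟩).imp ?_ id
        exact fun ⟨a, ha, haQ⟩ => ⟨a, .inl ha, haQ⟩
      · have hQB : Q ⊆ B := fun x hx => (hQ.subset hx).resolve_left fun hxA =>
          hAB x hxA q hqB (hQ.isClique hx hq fun h => hdisj hxA (h ▸ hqB))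
        refine (hTQ' Q ⟨hQB, ⟨q, hq⟩, hQ.isClique, fun z hz => hQ.mem z (.inr hz)⟩).imp ?_ id
        exact fun ⟨a, ha, haQ⟩ => ⟨a, .inr ha, haQ⟩
  · suffices h : ∃ J ⊆ A ∪ B, J.Nonempty ∧ ((A ∪ B) \ J).Nonempty ∧
        (∀ j ∈ J, ∀ x ∈ A ∪ B, x ∉ J → G.Adj j x) ∧ ∀ s ∈ S, ∀ j ∈ J, ¬ G.Adj s j by
      obtain ⟨J, hJ, ⟨j, hj⟩, ⟨x, hxR, hxJ⟩, hcomp, hJS⟩ := h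
      obtain ⟨T, hTJ, hT, -, hTQ⟩ := ih J ⟨hJ, fun h => hxJ (h hxR)⟩ (hP.mono hJ) ∅ (by simp)
        (by simp)
      refine ⟨T, hTJ.trans hJ, hT, fun s hs a ha => hJS s hs a (hTJ ha), fun Q hQ => .inl ?_⟩
      have hmem : ∀ z ∈ J, (∀ q ∈ Q ∩ J, z ≠ q → G.Adj z q) → z ∈ Q := fun z hz hzq =>
        hQ.mem z (hJ hz) fun q hq hne => by
          by_cases hqJ : q ∈ J
          · exact hzq q ⟨hq, hqJ⟩ hne
          · exact hcomp z hz q (hQ.subset hq) hqJ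
      have hne : (Q ∩ J).Nonempty := by
        by_contra hemp
        rw [Set.not_nonempty_iff_eq_empty] at hemp
        have := hmem j hj (by simp [hemp])
        have : j ∈ Q ∩ J := ⟨this, hj⟩
        simp [hemp] at this
      obtain ⟨a, ha, haQ⟩ := (hTQ (Q ∩ J) ⟨Set.inter_subset_right, hne,
        hQ.isClique.subset Set.inter_subset_left, fun z hz h => ⟨hmem z hz h, hz⟩⟩).resolve_right
          (by simp)
      exact ⟨a, ha, haQ.1⟩
    rw [Set.disjoint_left] at hdisj
    have hAB' : ∀ a ∈ A, ∀ b ∈ B, G.Adj a b := fun a ha b hb => by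
      have := hAB a ha b hb
      rw [compl_adj, not_and_not_right] at this
      exact this fun h => hdisj ha (h ▸ hb)
    obtain ⟨a₀, ha₀⟩ := hA
    obtain ⟨b₀, hb₀⟩ := hB
    by_cases hS : ∃ s ∈ S, ∃ x ∈ A ∪ B, G.Adj s x
    swap
    · push Not at hS
      refine ⟨A, Set.subset_union_left, ⟨a₀, ha₀⟩, ⟨b₀, .inr hb₀, fun h => hdisj h hb₀⟩,
        fun j hj x hx hxA => hAB' j hj x (hx.resolve_left hxA), fun s hs j hj => hS s hs j
          (.inl hj)⟩
    obtain ⟨s, ⟨hsS, x₀, hx₀, hsx⟩, hmax⟩ : ∃ s, (s ∈ S ∧ ∃ x ∈ A ∪ B, G.Adj s x) ∧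
        ∀ t ∈ S, (∀ x ∈ A ∪ B, G.Adj s x → G.Adj t x) → ∀ x ∈ A ∪ B, G.Adj t x → G.Adj s x := by
      obtain ⟨s, hs, hmax⟩ := Set.Finite.exists_maximalFor
        (fun s => {x | x ∈ A ∪ B ∧ G.Adj s x}) {s | s ∈ S ∧ ∃ x ∈ A ∪ B, G.Adj s x}
        (Set.toFinite _) (let ⟨s, hs, h⟩ := hS; ⟨s, hs, h⟩)
      obtain ⟨hsS, x, hx, hsx⟩ := hs
      refine ⟨s, ⟨hsS, x, hx, hsx⟩, fun t ht hst y hy hty => ?_⟩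
      exact (hmax (j := t) ⟨ht, x, hx, hst x hx hsx⟩ (fun z hz => ⟨hz.1, hst z hz.1 hz.2⟩)
        ⟨hy, hty⟩).2
    suffices h : ∃ J ⊆ A ∪ B, J.Nonempty ∧ (∀ j ∈ J, ∀ x ∈ A ∪ B, x ∉ J → G.Adj j x) ∧
        ∀ j ∈ J, ¬ G.Adj s j by
      obtain ⟨J, hJ, hne, hcomp, hJs⟩ := h
      have hx₀J : x₀ ∉ J := fun h => hJs x₀ h hsx
      refine ⟨J, hJ, hne, ⟨x₀, hx₀, hx₀J⟩, hcomp, fun t ht j hj htj => ?_⟩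
      refine hJs j hj (hmax t ht (fun x hx hsx => ?_) j (hJ hj) htj)
      exact hpath s hsS t ht x hx j (hJ hj) hsx
        (hcomp j hj x hx fun h => hJs x h hsx).symm htj.symm (hJs j hj)
    by_cases hsA : ∀ a ∈ A, ¬ G.Adj s a
    · exact ⟨A, Set.subset_union_left, ⟨a₀, ha₀⟩,
        fun j hj x hx hxA => hAB' j hj x (hx.resolve_left hxA), hsA⟩
    by_cases hsB : ∀ b ∈ B, ¬ G.Adj s b
    · exact ⟨B, Set.subset_union_right, ⟨b₀, hb₀⟩,
        fun j hj x hx hxB => (hAB' x (hx.resolve_right hxB) j hj).symm, hsB⟩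
    push Not at hsA hsB
    obtain ⟨a, ha, hsa⟩ := hsA
    obtain ⟨b, hb, hsb⟩ := hsB
    obtain ⟨j₀, hj₀, hsj₀⟩ := hs s hsS
    refine ⟨{j | j ∈ A ∪ B ∧ ¬ G.Adj s j}, fun j hj => hj.1, ⟨j₀, hj₀, hsj₀⟩, ?_, fun j hj => hj.2⟩
    rintro j ⟨hj, hsj⟩ x hx hxJ
    have hsx : G.Adj s x := by
      by_contra h
      exact hxJ ⟨hx, h⟩
    by_contra hjx
    rcases hj with hjA | hjB
    · have hxA : x ∈ A := hx.resolve_right fun h => hjx (hAB' j hjA x h)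
      exact hsj (htri s hsS b (.inr hb) x hx j (.inl hjA) (hAB' x hxA b hb).symm hsb hsx
        (hAB' j hjA b hb) hjx)
    · have hxB : x ∈ B := hx.resolve_left fun h => hjx (hAB' x h j hjB).symm
      exact hsj (htri s hsS a (.inl ha) x hx j (.inr hjB) (hAB' a ha x hxB) hsa hsx
        (hAB' a ha j hjB).symm hjx)

end Cographs

/-! ### Bull-free graphs -/

section BullFree

variable {V : Type*} {G : SimpleGraph V}

/-- `G` has no bull: a triangle `a b c` with pendant edges `a d` and `b e`. -/
def NoBull (G : SimpleGraph V) : Prop :=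
  ∀ a b c d e, G.Adj a b → G.Adj a c → G.Adj b c → G.Adj a d → G.Adj b e → ¬ G.Adj b d →
    ¬ G.Adj c d → ¬ G.Adj a e → ¬ G.Adj c e → ¬ G.Adj d e → False

theorem noBull_of_not_containsInduced (h : ¬ ContainsInduced BullGraph G) : NoBull G := by
  intro a b c d e hab hac hbc had hbe hbd hcd hae hce hde
  have hadj : ∀ i j : Fin 5, G.Adj (![a, b, c, d, e] i) (![a, b, c, d, e] j) ↔
      BullGraph.Adj i j := by
    intro i j
    fin_cases i <;> fin_cases j <;>
      simp [BullGraph, hab, hac, hbc, had, hbe, hbd, hcd, hae, hce, hde, hab.symm, hac.symm,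
        hbc.symm, had.symm, hbe.symm, G.adj_comm d, G.adj_comm e]
  refine h ⟨⟨![a, b, c, d, e], fun i j hij => ?_⟩, hadj⟩
  have htwin : ∀ i j : Fin 5, (∀ k, BullGraph.Adj i k ↔ BullGraph.Adj j k) → i = j := by
    simp only [BullGraph, fromEdgeSet_adj, Set.mem_insert_iff, Set.mem_singleton_iff]
    decide +kernel
  exact htwin i j fun k => by rw [← hadj, ← hadj, hij]

/-- An edge together with a vertex-disjoint, anticomplete induced path on four vertices. -/
theorem noP4On_of_adj (h : ¬ ContainsInduced P2UnionP4 G) {R : Set V} {p q : V} (hpq : G.Adj p q)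
    (hp : ∀ r ∈ R, ¬ G.Adj p r) (hq : ∀ r ∈ R, ¬ G.Adj q r) : NoP4On G R := by
  intro a ha b hb c hc d hd hab hbc hcd hac had hbd
  have hadj : ∀ i j : Fin 6, G.Adj (![p, q, a, b, c, d] i) (![p, q, a, b, c, d] j) ↔
      P2UnionP4.Adj i j := by
    have hp' : ∀ r ∈ R, ¬ G.Adj r p := fun r hr h => hp r hr h.symm
    have hq' : ∀ r ∈ R, ¬ G.Adj r q := fun r hr h => hq r hr h.symm
    intro i j
    fin_cases i <;> fin_cases j <;>
      simp [P2UnionP4, hpq, hpq.symm, hab, hbc, hcd, hab.symm, hbc.symm, hcd.symm, hac, had, hbd,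
        hp a ha, hp b hb, hp c hc, hp d hd, hq a ha, hq b hb, hq c hc, hq d hd,
        hp' a ha, hp' b hb, hp' c hc, hp' d hd, hq' a ha, hq' b hb, hq' c hc, hq' d hd,
        G.adj_comm c a, G.adj_comm d a, G.adj_comm d b]
  refine h ⟨⟨![p, q, a, b, c, d], fun i j hij => ?_⟩, hadj⟩
  have htwin : ∀ i j : Fin 6, (∀ k, P2UnionP4.Adj i k ↔ P2UnionP4.Adj j k) → i = j := by
    simp only [P2UnionP4, fromEdgeSet_adj, Set.mem_insert_iff, Set.mem_singleton_iff]
    decide +kernel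
  exact htwin i j fun k => by rw [← hadj, ← hadj, hij]

theorem adj_of_not_compl_adj {a b : V} (h : ¬ Gᶜ.Adj a b) (hne : a ≠ b) : G.Adj a b := by
  simpa [hne] using h

theorem NoBull.compl (h : NoBull G) : NoBull Gᶜ := by
  intro a b c d e hab hac hbc had hbe hbd hcd hae hce hde
  have hde' : d ≠ e := fun e => hae (e ▸ had)
  have hbd' : b ≠ d := fun e => hcd (e ▸ hbc.symm)
  have hae' : a ≠ e := fun e => hce (e ▸ hac.symm)
  have hcd' : c ≠ d := fun e => hbd (e ▸ hbc)
  have hce' : c ≠ e := fun e => hae (e ▸ hac)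
  exact h d e c b a (adj_of_not_compl_adj hde hde') (adj_of_not_compl_adj hcd hcd').symm
    (adj_of_not_compl_adj hce hce').symm (adj_of_not_compl_adj hbd hbd').symm
    (adj_of_not_compl_adj hae hae').symm (fun e => hbe.2 e.symm) hbc.symm.2
    (fun e => had.2 e.symm) hac.symm.2 hab.symm.2

theorem IsPrimeOn.compl {Y : Set V} (h : IsPrimeOn G Y) : IsPrimeOn Gᶜ Y := by
  intro X hXY hX hhom
  refine h X hXY hX fun y hy hyX a ha b hb hya => ?_
  by_contra hyb
  exact (hhom y hy hyX b hb a ha ⟨fun e => hyX (e ▸ hb), hyb⟩).2 hya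

theorem IsSplitOn.of_compl {H : Set V} (h : IsSplitOn Gᶜ H) : IsSplitOn G H := by
  obtain ⟨R, S, hRS, hR, hS⟩ := h
  refine ⟨S, {a | a ∈ R}, fun x hx => (hRS hx).symm, fun a ha b hb hne => ?_, fun a ha b hb hab =>
      ?_⟩
  · exact adj_of_not_compl_adj (hS a ha b hb) hne
  · exact (hR ha hb hab.ne).2 hab

theorem isSplitOn_compl {H : Set V} : IsSplitOn Gᶜ H ↔ IsSplitOn G H :=
  ⟨IsSplitOn.of_compl, fun h => IsSplitOn.of_compl (by rwa [compl_compl])⟩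

/-- A subset `N` of a prime set `H` that contains an edge is all of `H`, if outside vertices cannot
distinguish the ends of an edge of `N`. -/
theorem IsPrimeOn.subset_of_adj {H N : Set V} (h : IsPrimeOn G H) (hN : N ⊆ H) {k₀ k₁ : V}
    (hk₀ : k₀ ∈ N) (hk₁ : k₁ ∈ N) (hadj : G.Adj k₀ k₁)
    (hout : ∀ y ∈ H, y ∉ N → ∀ k ∈ N, ∀ k' ∈ N, G.Adj k k' → G.Adj y k → G.Adj y k') : H ⊆ N := by
  let K : Set V := {z | Relation.ReflTransGen (fun a b => G.Adj a b ∧ b ∈ N) k₀ z}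
  have hKN : K ⊆ N := fun z hz => mem_of_reflTransGen hk₀ hz
  refine (h K (hKN.trans hN) ⟨k₀, .refl, k₁, .single ⟨hadj, hk₁⟩, hadj.ne⟩ ?_).trans hKN
  intro y hy hyK
  have hyN : ∀ k ∈ K, G.Adj y k → y ∉ N := fun k hk hyk hyN => hyK (hk.tail ⟨hyk.symm, hyN⟩)
  have key : ∀ k ∈ K, y ∉ N → (G.Adj y k ↔ G.Adj y k₀) := fun k hk hyN => by
    induction hk with
    | refl => rfl
    | @tail b c hb hbc ih =>
      rw [← ih]
      exact ⟨hout y hy hyN c hbc.2 b (hKN hb) hbc.1.symm, hout y hy hyN b (hKN hb) c hbc.2 hbc.1⟩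
  intro a ha b hb hya
  have := hyN a ha hya
  rwa [key b hb this, ← key a ha this]

theorem exists_ne_ne_of_not_isSplitOn {H : Set V} (h : ¬ IsSplitOn G H) (p q : V) :
    ∃ r ∈ H, r ≠ p ∧ r ≠ q := by
  by_contra! hcon
  by_cases hpq : G.Adj p q
  · refine h ⟨{p, q}, ∅, fun r hr => .inl ?_, by simp [isClique_insert, hpq], by simp⟩
    by_contra hr'
    simp only [Set.mem_insert_iff, Set.mem_singleton_iff, not_or] at hr'
    exact hr'.2 (hcon r hr hr'.1)
  · refine h ⟨∅, {p, q}, fun r hr => .inr ?_, by simp, by simp [hpq, G.adj_comm q p]⟩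
    by_contra hr'
    simp only [Set.mem_insert_iff, Set.mem_singleton_iff, not_or] at hr'
    exact hr'.2 (hcon r hr hr'.1)

/-- In a prime set that is not split, the neighbours and the nonneighbours of any vertex are
joined by an edge. -/
theorem IsPrimeOn.exists_adj {H : Set V} (h : IsPrimeOn G H) (hns : ¬ IsSplitOn G H) {x p q : V}
    (hp : p ∈ H) (hq : q ∈ H) (hxp : G.Adj x p) (hxq : ¬ G.Adj x q) :
    ∃ k ∈ H, ∃ k' ∈ H, G.Adj x k ∧ ¬ G.Adj x k' ∧ G.Adj k k' := by
  by_contra! hcon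
  obtain ⟨r, hr, hrp, hrq⟩ := exists_ne_ne_of_not_isSplitOn hns p q
  by_cases hxr : G.Adj x r
  · refine hxq (h {k | k ∈ H ∧ G.Adj x k} (fun k hk => hk.1) ⟨r, ⟨hr, hxr⟩, p, ⟨hp, hxp⟩, hrp⟩
      (fun y hy hyX a ha b hb hya => ?_) hq).2
    exact absurd hya.symm (hcon a ha.1 y hy ha.2 fun e => hyX ⟨hy, e⟩)
  · refine (h {k | k ∈ H ∧ ¬ G.Adj x k} (fun k hk => hk.1) ⟨r, ⟨hr, hxr⟩, q, ⟨hq, hxq⟩, hrq⟩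
      (fun y hy hyX a ha b hb hya => ?_) hp).2 hxp
    exact absurd hya (hcon y hy a ha.1 (by_contra fun e => hyX ⟨hy, e⟩) ha.2)

theorem IsPrimeOn.exists_not_adj {H : Set V} (h : IsPrimeOn G H) (hns : ¬ IsSplitOn G H)
    {x p q : V} (hx : x ∉ H) (hp : p ∈ H) (hq : q ∈ H) (hxp : G.Adj x p) (hxq : ¬ G.Adj x q) :
    ∃ k ∈ H, ∃ k' ∈ H, G.Adj x k ∧ ¬ G.Adj x k' ∧ ¬ G.Adj k k' := by
  obtain ⟨k, hk, k', hk', h1, h2, h3⟩ := h.compl.exists_adj (x := x) (by rwa [isSplitOn_compl])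
    hq hp ⟨fun e => hx (e ▸ hq), hxq⟩ fun h => h.2 hxp
  exact ⟨k', hk', k, hk, adj_of_not_compl_adj h2 fun e => hx (e ▸ hk'), h1.2,
    fun e => h3.2 e.symm⟩

/-- If `x` has a neighbour that is anticomplete to the prime set `H`, then `x` is complete to
`H` or its neighbours in `H` form a stable set. -/
theorem NoBull.subset_of_anticomplete (hb : NoBull G) {H : Set V} (h : IsPrimeOn G H) {x a : V}
    (ha : ∀ y ∈ H, ¬ G.Adj a y) (hxa : G.Adj x a) {k k' : V} (hk : k ∈ H) (hk' : k' ∈ H)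
    (hxk : G.Adj x k) (hxk' : G.Adj x k') (hkk' : G.Adj k k') : ∀ y ∈ H, G.Adj x y := by
  have := h.subset_of_adj (N := {y | y ∈ H ∧ G.Adj x y}) (fun y hy => hy.1) ⟨hk, hxk⟩ ⟨hk', hxk'⟩
    hkk' fun y hy hyN c hc d hd hcd hyc => by
      by_contra hyd
      exact hb x c d a y hc.2 hd.2 hcd hxa hyc.symm (fun e => ha c hc.1 e.symm)
        (fun e => ha d hd.1 e.symm) (fun e => hyN ⟨hy, e⟩) (fun e => hyd e.symm) (ha y hy)
  exact fun y hy => (this hy).2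

theorem NoBull.adj_of_mixed (hb : NoBull G) {H : Set V} (h : IsPrimeOn G H)
    (hns : ¬ IsSplitOn G H) {x p q a c : V} (hx : x ∉ H) (hp : p ∈ H) (hq : q ∈ H)
    (hxp : G.Adj x p) (hxq : ¬ G.Adj x q) (ha : ∀ y ∈ H, ¬ G.Adj a y) (hc : ∀ y ∈ H, G.Adj c y)
    (hxa : G.Adj x a) : G.Adj x c := by
  by_contra hxc
  have hne : x ≠ c := fun e => hxq (e ▸ hc q hq)
  refine hns ⟨{y | y ∈ H ∧ ¬ G.Adj x y}, {y | y ∈ H ∧ G.Adj x y}, fun y hy => ?_,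
    fun k hk k' hk' hkk' => ?_, fun k hk k' hk' hkk' => ?_⟩
  · by_cases hxy : G.Adj x y
    exacts [.inr ⟨hy, hxy⟩, .inl ⟨hy, hxy⟩]
  · by_contra hadj
    have hxH : ∀ y ∈ H, x ≠ y := fun y hy e => hx (e ▸ hy)
    exact (hb.compl.subset_of_anticomplete h.compl (x := x) (a := c) (fun y hy => by simp [hc y hy])
      ⟨hne, hxc⟩ hk.1 hk'.1 ⟨hxH _ hk.1, hk.2⟩ ⟨hxH _ hk'.1, hk'.2⟩ ⟨hkk', hadj⟩ p hp).2 hxp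
  · exact hxq (hb.subset_of_anticomplete h ha hxa hk.1 hk'.1 hk.2 hk'.2 hkk' q hq)

/-- Under the hypotheses of `NoBull.adj_of_mixed`, adjacent `a` and `c` force `x` to be adjacent
to `c`. -/
theorem NoBull.adj_center_of_mixed (hb : NoBull G) {H : Set V} (h : IsPrimeOn G H)
    (hns : ¬ IsSplitOn G H) {x p q a c : V} (hx : x ∉ H) (hp : p ∈ H) (hq : q ∈ H)
    (hxp : G.Adj x p) (hxq : ¬ G.Adj x q) (ha : ∀ y ∈ H, ¬ G.Adj a y) (hc : ∀ y ∈ H, G.Adj c y)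
    (hca : G.Adj c a) : G.Adj x c := by
  by_contra hxc
  have hxa : ¬ G.Adj x a := fun e => hxc (hb.adj_of_mixed h hns hx hp hq hxp hxq ha hc e)
  obtain ⟨k, hk, k', hk', hxk, hxk', hkk'⟩ := h.exists_adj hns hp hq hxp hxq
  exact hb k c k' x a (hc k hk).symm hkk' (hc k' hk') hxk.symm hca (fun e => hxc e.symm)
    (fun e => hxk' e.symm) (fun e => ha k hk e.symm) (fun e => ha k' hk' e.symm) hxa

/-- Under the hypotheses of `NoBull.adj_of_mixed`, nonadjacent `a` and `c` force `x` to be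
nonadjacent to `a`. -/
theorem NoBull.not_adj_anticenter_of_mixed (hb : NoBull G) {H : Set V} (h : IsPrimeOn G H)
    (hns : ¬ IsSplitOn G H) {x p q a c : V} (hx : x ∉ H) (hp : p ∈ H) (hq : q ∈ H)
    (hxp : G.Adj x p) (hxq : ¬ G.Adj x q) (ha : ∀ y ∈ H, ¬ G.Adj a y) (hc : ∀ y ∈ H, G.Adj c y)
    (hca : ¬ G.Adj c a) : ¬ G.Adj x a := by
  intro hxa
  have hxc := hb.adj_of_mixed h hns hx hp hq hxp hxq ha hc hxa
  obtain ⟨k, hk, k', hk', hxk, hxk', hkk'⟩ := h.exists_not_adj hns hx hp hq hxp hxq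
  exact hb c x k k' a hxc.symm (hc k hk) hxk (hc k' hk') hxa hxk' hkk' hca
    (fun e => ha k hk e.symm) fun e => ha k' hk' e.symm

/-- A prime nonsplit set inside a larger prime set does not have a complete vertex, if all complete
vertices have anticomplete neighbours. -/
theorem NoBull.exists_center_of_center (hb : NoBull G) {Y H : Set V} (hY : IsPrimeOn G Y)
    (hHY : H ⊆ Y) (h : IsPrimeOn G H) (hns : ¬ IsSplitOn G H) {c : V} (hcY : c ∈ Y)
    (hc : ∀ y ∈ H, G.Adj c y) :
    ∃ c ∈ Y, (∀ y ∈ H, G.Adj c y) ∧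
      ∀ a ∈ Y, a ∉ H → (∀ y ∈ H, ¬ G.Adj a y) → ¬ G.Adj c a := by
  by_contra! hcon
  let C : Set V := {c | c ∈ Y ∧ ∀ y ∈ H, G.Adj c y}
  let A : Set V := {a | a ∈ Y ∧ a ∉ H ∧ ∀ y ∈ H, ¬ G.Adj a y}
  let A₁ : Set V := {a | a ∈ A ∧ ∃ c ∈ C, ¬ G.Adj c a}
  let A₂ : Set V := {a | a ∈ A ∧ a ∉ A₁ ∧ ∃ a' ∈ A₁, G.Adj a a'}
  let W : Set V := C ∪ A₁ ∪ A₂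
  obtain ⟨h₀, hh₀, -⟩ := exists_ne_ne_of_not_isSplitOn hns c c
  obtain ⟨h₁, hh₁, hne, -⟩ := exists_ne_ne_of_not_isSplitOn hns h₀ h₀
  have hHC : ∀ y ∈ H, y ∉ C := fun y hy hyC => G.irrefl (hyC.2 y hy)
  have hHW : ∀ y ∈ H, y ∉ W := by
    rintro y hy ((hyC | hyA) | hyA)
    exacts [hHC y hy hyC, hyA.1.2.1 hy, hyA.1.2.1 hy]
  have hmix : ∀ m ∈ Y, m ∉ H → m ∉ C → m ∉ A → ∃ p ∈ H, ∃ q ∈ H, G.Adj m p ∧ ¬ G.Adj m q := by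
    intro m hm hmH hmC hmA
    by_contra! hno
    refine hmA ⟨hm, hmH, fun y hy hmy => hmC ⟨hm, fun z hz => hno y hy z hz hmy⟩⟩
  have hMC : ∀ m ∈ Y, m ∉ H → m ∉ C → m ∉ A → ∀ c ∈ C, G.Adj m c := by
    intro m hm hmH hmC hmA c hc
    obtain ⟨p, hp, q, hq, hmp, hmq⟩ := hmix m hm hmH hmC hmA
    obtain ⟨a, ha, haH, haA, hca⟩ := hcon c hc.1 hc.2
    exact hb.adj_center_of_mixed h hns hmH hp hq hmp hmq haA hc.2 hca
  have hMA : ∀ m ∈ Y, m ∉ H → m ∉ C → m ∉ A → ∀ a ∈ A₁, ¬ G.Adj m a := by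
    rintro m hm hmH hmC hmA a ⟨ha, c, hc, hca⟩
    obtain ⟨p, hp, q, hq, hmp, hmq⟩ := hmix m hm hmH hmC hmA
    exact hb.not_adj_anticenter_of_mixed h hns hmH hp hq hmp hmq ha.2.2 hc.2 hca
  have hAC : ∀ a ∈ A, a ∉ A₁ → ∀ c ∈ C, G.Adj c a := fun a ha ha₁ c hc => by
    by_contra hca
    exact ha₁ ⟨ha, c, hc, hca⟩
  refine (hY (Y \ W) Set.sdiff_subset ⟨h₀, ⟨hHY hh₀, hHW h₀ hh₀⟩, h₁, ⟨hHY hh₁, hHW h₁ hh₁⟩,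
    hne.symm⟩ ?_ hcY).2 (.inl (.inl ⟨hcY, hc⟩))
  suffices key : ∀ w ∈ W, (∀ z ∈ Y, z ∉ W → G.Adj w z) ∨ ∀ z ∈ Y, z ∉ W → ¬ G.Adj w z by
    intro y hy hyW z hz z' hz' hyz
    have hyW : y ∈ W := by_contra fun e => hyW ⟨hy, e⟩
    rcases key y hyW with hk | hk
    · exact hk z' hz'.1 hz'.2
    · exact absurd hyz (hk z hz.1 hz.2)
  have hcases : ∀ z ∈ Y, z ∉ W → z ∈ H ∨ (z ∈ A ∧ z ∉ A₁ ∧ ∀ a' ∈ A₁, ¬ G.Adj z a') ∨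
      (z ∉ H ∧ z ∉ C ∧ z ∉ A) := by
    intro z hz hzW
    by_cases hzH : z ∈ H
    · exact .inl hzH
    by_cases hzA : z ∈ A
    · have hzA₁ : z ∉ A₁ := fun e => hzW (.inl (.inr e))
      exact .inr (.inl ⟨hzA, hzA₁, fun a' ha' hadj => hzW (.inr ⟨hzA, hzA₁, a', ha', hadj⟩)⟩)
    · exact .inr (.inr ⟨hzH, fun e => hzW (.inl (.inl e)), hzA⟩)
  rintro w ((hw | hw) | ⟨hwA, hwA₁, a', ha', hwa'⟩)
  · refine .inl fun z hz hzW => ?_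
    rcases hcases z hz hzW with hzH | ⟨hzA, hzA₁, -⟩ | ⟨hzH, hzC, hzA⟩
    · exact hw.2 z hzH
    · exact hAC z hzA hzA₁ w hw
    · exact (hMC z hz hzH hzC hzA w hw).symm
  · refine .inr fun z hz hzW hwz => ?_
    rcases hcases z hz hzW with hzH | ⟨-, -, hza⟩ | ⟨hzH, hzC, hzA⟩
    · exact hw.1.2.2 z hzH hwz
    · exact hza w hw hwz.symm
    · exact hMA z hz hzH hzC hzA w hw hwz.symm
  · refine .inr fun z hz hzW hwz => ?_
    obtain ⟨ha'A, c, hcC, hca'⟩ := ha'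
    have hcw := hAC w hwA hwA₁ c hcC
    have hbull : ∀ y ∈ H, G.Adj c z → ¬ G.Adj z a' → ¬ G.Adj z y → False := fun y hy hcz hza hzy =>
      hb c w z y a' hcw hcz hwz (hcC.2 y hy) hwa' (hwA.2.2 y hy) hzy hca' hza
        fun e => ha'A.2.2 y hy e.symm
    rcases hcases z hz hzW with hzH | ⟨hzA, hzA₁, hza⟩ | ⟨hzH, hzC, hzA⟩
    · exact hwA.2.2 z hzH hwz
    · exact hbull h₀ hh₀ (hAC z hzA hzA₁ c hcC) (hza a' ⟨ha'A, c, hcC, hca'⟩) (hzA.2.2 h₀ hh₀)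
    · obtain ⟨p, hp, q, hq, hmp, hmq⟩ := hmix z hz hzH hzC hzA
      exact hbull q hq (hMC z hz hzH hzC hzA c hcC).symm
        (hMA z hz hzH hzC hzA a' ⟨ha'A, c, hcC, hca'⟩) hmq

/-- A prime nonsplit set inside a larger prime set does not have both a complete and an anticomplete
vertex. -/
theorem NoBull.not_center_of_anticenter (hb : NoBull G) {Y H : Set V} (hY : IsPrimeOn G Y)
    (hHY : H ⊆ Y) (h : IsPrimeOn G H) (hns : ¬ IsSplitOn G H) {a c : V} (haY : a ∈ Y)
    (haH : a ∉ H) (ha : ∀ y ∈ H, ¬ G.Adj a y) (hcY : c ∈ Y) : ¬ ∀ y ∈ H, G.Adj c y := by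
  intro hc
  obtain ⟨c', hc'Y, hc', hca⟩ := hb.exists_center_of_center hY hHY h hns hcY hc
  have hne : ∀ y ∈ H, ∀ z, z ∉ H → z ≠ y := fun y hy z hz e => hz (e ▸ hy)
  obtain ⟨a', ha'Y, ha', hac⟩ := hb.compl.exists_center_of_center hY.compl hHY h.compl
    (by rwa [isSplitOn_compl]) haY fun y hy => ⟨hne y hy a haH, ha y hy⟩
  have ha'H : a' ∉ H := fun e => (ha' a' e).1 rfl
  have hc'H : c' ∉ H := fun e => G.irrefl (hc' c' e)
  obtain ⟨y, hy, -⟩ := exists_ne_ne_of_not_isSplitOn hns a a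
  refine hac c' hc'Y hc'H (fun y hy e => e.2 (hc' y hy)) ⟨fun e => (ha' y hy).2 (e ▸ hc' y hy), ?_⟩
  exact fun e => hca a' ha'Y ha'H (fun y hy => (ha' y hy).2) e.symm

theorem NoBull.not_adj_of_adj_anticenter (hb : NoBull G) {Y H : Set V} (hY : IsPrimeOn G Y)
    (hHY : H ⊆ Y) (h : IsPrimeOn G H) (hns : ¬ IsSplitOn G H) {v x k k' : V} (hvY : v ∈ Y)
    (hvH : v ∉ H) (hv : ∀ y ∈ H, ¬ G.Adj v y) (hx : x ∈ Y) (hvx : G.Adj v x) (hk : k ∈ H)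
    (hk' : k' ∈ H) (hxk : G.Adj x k) (hxk' : G.Adj x k') : ¬ G.Adj k k' := fun hkk' =>
  hb.not_center_of_anticenter hY hHY h hns hvY hvH hv hx
    (hb.subset_of_anticomplete h hv hvx.symm hk hk' hxk hxk' hkk')

/-- Let `v u x` be a triangle and let `u s a b t` be a `5`-cycle without neighbours of `v` other
than `u`. If the neighbours of `x` on the path `s a b t` form a stable set, then these are
`s` and `t`. -/
theorem NoBull.clone (hb : NoBull G) (hP : ¬ ContainsInduced P2UnionP4 G) {v u x s a b t : V}
    (hvu : G.Adj v u) (hvx : G.Adj v x) (hux : G.Adj u x) (hsa : G.Adj s a) (hab : G.Adj a b)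
    (hbt : G.Adj b t) (hsb : ¬ G.Adj s b) (hat : ¬ G.Adj a t) (hst : ¬ G.Adj s t)
    (hvs : ¬ G.Adj v s) (hva : ¬ G.Adj v a) (hvb : ¬ G.Adj v b) (hvt : ¬ G.Adj v t)
    (hus : G.Adj u s) (hut : G.Adj u t) (hua : ¬ G.Adj u a) (hub : ¬ G.Adj u b)
    (hxsa : G.Adj x s → ¬ G.Adj x a) (hxab : G.Adj x a → ¬ G.Adj x b)
    (hxbt : G.Adj x b → ¬ G.Adj x t) :
    G.Adj x s ∧ G.Adj x t ∧ ¬ G.Adj x a ∧ ¬ G.Adj x b := by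
  have hsb' : ¬ G.Adj b s := fun e => hsb e.symm
  have hat' : ¬ G.Adj t a := fun e => hat e.symm
  have hst' : ¬ G.Adj t s := fun e => hst e.symm
  have hxab' : G.Adj x b → ¬ G.Adj x a := fun h h' => hxab h' h
  by_cases hxs : G.Adj x s
  · have hxa := hxsa hxs
    by_cases hxt : G.Adj x t
    · exact ⟨hxs, hxt, hxa, fun e => hxbt e hxt⟩
    · exact (hb u s x t a hus hux hxs.symm hut hsa hst hxt hua hxa hat').elim
  by_cases hxt : G.Adj x t
  · have hxb : ¬ G.Adj x b := fun e => hxbt e hxt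
    exact (hb u t x s b hut hux hxt.symm hus hbt.symm hst' hxs hub hxb hsb).elim
  by_cases hxa : G.Adj x a
  · exact (hb u x v t a hux hvu.symm hvx.symm hut hxa hxt hvt hua hva hat').elim
  by_cases hxb : G.Adj x b
  · exact (hb u x v s b hux hvu.symm hvx.symm hus hxb hxs hvs hub hvb hsb).elim
  refine (noP4On_of_adj hP (R := {s, a, b, t}) hvx ?_ ?_ s ?_ a ?_ b ?_ t ?_ hsa hab hbt hsb hst
    hat).elim
  all_goals simp [hvs, hva, hvb, hvt, hxs, hxa, hxb, hxt]

/-- Let `v`, `z`, `x` be a triangle, `z` and `x` being adjacent to `s` and `t` and not to `a` and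
`b`, where `s a b t` is an induced path without neighbours of `v`. Then all nonneighbours of `v`
that are adjacent to `z` are adjacent to `x`. -/
theorem NoBull.adj_of_adj_clone (hb : NoBull G) {v z x s a b t y : V} (hvz : G.Adj v z)
    (hzx : G.Adj z x) (hsa : G.Adj s a) (hab : G.Adj a b) (hbt : G.Adj b t) (hsb : ¬ G.Adj s b)
    (hat : ¬ G.Adj a t) (hst : ¬ G.Adj s t) (hvs : ¬ G.Adj v s) (hva : ¬ G.Adj v a)
    (hvb : ¬ G.Adj v b) (hvt : ¬ G.Adj v t) (hzs : G.Adj z s) (hzt : G.Adj z t)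
    (hza : ¬ G.Adj z a) (hzb : ¬ G.Adj z b) (hxs : G.Adj x s) (hxt : G.Adj x t)
    (hxa : ¬ G.Adj x a) (hxb : ¬ G.Adj x b) (hvy : ¬ G.Adj v y) (hzy : G.Adj z y) :
    G.Adj x y := by
  by_contra hxy
  have hsb' : ¬ G.Adj b s := fun e => hsb e.symm
  have hat' : ¬ G.Adj t a := fun e => hat e.symm
  have hst' : ¬ G.Adj t s := fun e => hst e.symm
  have hvy' : ¬ G.Adj y v := fun e => hvy e.symm
  have hvs' : ¬ G.Adj s v := fun e => hvs e.symm
  have hvt' : ¬ G.Adj t v := fun e => hvt e.symm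
  have sym : ∀ {p q}, ¬ G.Adj p q → ¬ G.Adj q p := fun h e => h e.symm
  have h1 : G.Adj y s ∨ G.Adj y a := by
    by_contra! h
    exact hb z s x y a hzs hzx hxs.symm hzy hsa (sym h.1) hxy hza hxa h.2
  have h2 : G.Adj y t ∨ G.Adj y b := by
    by_contra! h
    exact hb z t x y b hzt hzx hxt.symm hzy hbt.symm (sym h.1) hxy hzb hxb h.2
  have h3 : ¬ (G.Adj y s ∧ G.Adj y b) := fun h =>
    hb z y s v b hzy hzs h.1 hvz.symm h.2 hvy' hvs' hzb hsb hvb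
  have h4 : ¬ (G.Adj y t ∧ G.Adj y a) := fun h =>
    hb z y t v a hzy hzt h.1 hvz.symm h.2 hvy' hvt' hza hat' hva
  have h5 : ¬ (G.Adj y s ∧ ¬ G.Adj y a) := fun h =>
    hb z s y v a hzs hzy h.1.symm hvz.symm hsa hvs' hvy' hza h.2 hva
  have h6 : ¬ (¬ G.Adj y s ∧ G.Adj y a ∧ G.Adj y b ∧ ¬ G.Adj y t) := fun h =>
    hb a b y s t hab h.2.1.symm h.2.2.1.symm hsa.symm hbt hsb' h.1 hat h.2.2.2 hst
  tauto

theorem NoBull.not_path (hb : NoBull G) (hP : ¬ ContainsInduced P2UnionP4 G) {Y H : Set V}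
    (hY : IsPrimeOn G Y) (hHY : H ⊆ Y) (h : IsPrimeOn G H) (hns : ¬ IsSplitOn G H)
    {v u w s a b t : V} (hvY : v ∈ Y) (hvH : v ∉ H) (hv : ∀ y ∈ H, ¬ G.Adj v y) (hu : u ∈ Y)
    (hw : w ∈ Y) (hvu : G.Adj v u) (hvw : G.Adj v w) (huw : G.Adj u w) (hs : s ∈ H) (ha : a ∈ H)
    (hbH : b ∈ H) (ht : t ∈ H) (hus : G.Adj u s) (hua : ¬ G.Adj u a) (hub : ¬ G.Adj u b)
    (hut : G.Adj u t) (hsa : G.Adj s a) (hab : G.Adj a b) (hbt : G.Adj b t) (hsb : ¬ G.Adj s b) :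
    G.Adj t a := by
  by_contra hat
  replace hat : ¬ G.Adj a t := fun e => hat e.symm
  have hstable : ∀ x ∈ Y, G.Adj v x → ∀ k ∈ H, ∀ k' ∈ H, G.Adj x k → G.Adj x k' → ¬ G.Adj k k' :=
    fun x hx hvx k hk k' hk' => hb.not_adj_of_adj_anticenter hY hHY h hns hvY hvH hv hx hvx hk hk'
  have hst := hstable u hu hvu s hs t ht hus hut
  let X : Set V := {z | Relation.ReflTransGen (fun a b => G.Adj a b ∧ (G.Adj v b ∧ b ∈ Y)) u z}
  have hX : ∀ x ∈ X, (G.Adj v x ∧ x ∈ Y) ∧ G.Adj x s ∧ G.Adj x t ∧ ¬ G.Adj x a ∧ ¬ G.Adj x b := by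
    intro x hx
    induction hx with
    | refl => exact ⟨⟨hvu, hu⟩, hus, hut, hua, hub⟩
    | @tail y z _ hyz ih =>
      obtain ⟨⟨hvy, hyY⟩, hys, hyt, hya, hyb⟩ := ih
      obtain ⟨hyz, hvz, hzY⟩ := hyz
      refine ⟨⟨hvz, hzY⟩, hb.clone hP hvy hvz hyz hsa hab hbt hsb hat hst (hv s hs) (hv a ha)
        (hv b hbH) (hv t ht) hys hyt hya hyb (fun e e' => ?_) (fun e e' => ?_) fun e e' => ?_⟩
      exacts [hstable z hzY hvz s hs a ha e e' hsa, hstable z hzY hvz a ha b hbH e e' hab,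
        hstable z hzY hvz b hbH t ht e e' hbt]
  have hstep : ∀ y ∈ Y, y ∉ X → ∀ x ∈ X, ∀ z ∈ X, G.Adj x z → (G.Adj y x ↔ G.Adj y z) := by
    have : ∀ y ∈ Y, y ∉ X → ∀ x ∈ X, ∀ z ∈ X, G.Adj x z → G.Adj y x → G.Adj y z := by
      intro y hy hyX x hx z hz hxz hyx
      have hvy : ¬ G.Adj v y := fun hvy => hyX (hx.tail ⟨hyx.symm, hvy, hy⟩)
      obtain ⟨⟨hvx, -⟩, hxs, hxt, hxa, hxb⟩ := hX x hx
      obtain ⟨-, hzs, hzt, hza, hzb⟩ := hX z hz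
      exact (hb.adj_of_adj_clone hvx hxz hsa hab hbt hsb hat hst (hv s hs) (hv a ha) (hv b hbH)
        (hv t ht) hxs hxt hxa hxb hzs hzt hza hzb hvy hyx.symm).symm
    exact fun y hy hyX x hx z hz hxz => ⟨this y hy hyX x hx z hz hxz,
      this y hy hyX z hz x hx hxz.symm⟩
  have huX : u ∈ X := Relation.ReflTransGen.refl
  have hwX : w ∈ X := Relation.ReflTransGen.single ⟨huw, hvw, hw⟩
  refine G.irrefl (hX v (hY X (fun x hx => (hX x hx).1.2) ⟨u, huX, w, hwX, huw.ne⟩ ?_ hvY)).1.1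
  intro y hy hyX p hp q hq hyp
  have key : ∀ x ∈ X, G.Adj y x ↔ G.Adj y u := fun x hx => by
    induction hx with
    | refl => rfl
    | @tail c d hc hcd ih =>
      rw [← ih]
      exact (hstep y hy hyX c hc d (hc.tail hcd) hcd.1).symm
  rwa [key q hq, ← key p hp]

/-- In a prime set, the nonneighbours of a vertex of a triangle induce a strongly perfect graph. -/
theorem NoBull.isStronglyPerfect_of_triangle [Finite V] (hb : NoBull G)
    (hP : ¬ ContainsInduced P2UnionP4 G) {Y : Set V} (hY : IsPrimeOn G Y) {v u w : V} (hv : v ∈ Y)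
    (hu : u ∈ Y) (hw : w ∈ Y) (hvu : G.Adj v u) (hvw : G.Adj v w) (huw : G.Adj u w) :
    IsStronglyPerfect G {y | y ∈ Y ∧ y ≠ v ∧ ¬ G.Adj v y} := by
  refine isStronglyPerfect_of_isPrimeOn fun H hH h => ?_
  by_cases hsplit : IsSplitOn G H
  · exact hsplit.hasStableTransversal
  have hHY : H ⊆ Y := fun y hy => (hH hy).1
  have hvH : v ∉ H := fun e => (hH e).2.1 rfl
  have hvadj : ∀ y ∈ H, ¬ G.Adj v y := fun y hy => (hH hy).2.2
  have hstable : ∀ k ∈ H, ∀ k' ∈ H, G.Adj u k → G.Adj u k' → ¬ G.Adj k k' :=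
    fun k hk k' hk' => hb.not_adj_of_adj_anticenter hY hHY h hsplit hv hvH hvadj hu hvu hk hk'
  obtain ⟨T, hTR, hT, hTS, hTQ⟩ := NoP4On.exists_stable (G := G) (R := {y | y ∈ H ∧ ¬ G.Adj u y})
    (noP4On_of_adj hP hvu (fun y hy => hvadj y hy.1) fun y hy => hy.2) {y | y ∈ H ∧ G.Adj u y}
    (fun s hs k hk k' hk' c hc hkk' hsk hsk' hck hck' => by
      by_contra hsc
      exact hb s k k' u c hsk hsk' hkk' hs.2.symm hck.symm (fun e => hk.2 e.symm)
        (fun e => hk'.2 e.symm) hsc (fun e => hck' e.symm) hc.2)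
    (fun s hs t ht a ha b hbR hsa hab hbt hsb => hb.not_path hP hY hHY h hsplit hv hvH hvadj hu hw
      hvu hvw huw hs.1 ha.1 hbR.1 ht.1 hs.2 ha.2 hbR.2 ht.2 hsa hab hbt hsb)
  refine ⟨{y | y ∈ H ∧ (G.Adj u y ∨ y ∈ T)}, fun y hy => hy.1, ?_, fun Q hQ => ?_⟩
  · rintro p ⟨hp, hup | hpT⟩ q ⟨hq, huq | hqT⟩ hpq
    exacts [hstable p hp q hq hup huq hpq, hTS p ⟨hp, hup⟩ q hqT hpq,
      hTS q ⟨hq, huq⟩ p hpT hpq.symm, hT p hpT q hqT hpq]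
  · by_contra! hcon
    have hQR : Q ⊆ {y | y ∈ H ∧ ¬ G.Adj u y} := fun q hq =>
      ⟨hQ.subset hq, fun e => hcon q ⟨hQ.subset hq, .inl e⟩ hq⟩
    rcases hTQ Q ⟨hQR, hQ.nonempty, hQ.isClique, fun z hz => hQ.mem z hz.1⟩ with
      ⟨a, ha, haQ⟩ | ⟨s, hs, hsQ⟩
    · exact hcon a ⟨(hTR ha).1, .inr ha⟩ haQ
    · exact (hQR (hQ.mem s hs.1 fun q hq _ => hsQ q hq)).2 hs.2

theorem IsStronglyPerfect.insert_of_anticomplete {A : Set V} {v : V} (hA : IsStronglyPerfect G A)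
    (hv : ∀ y ∈ A, ¬ G.Adj v y) : IsStronglyPerfect G (insert v A) := by
  intro Z hZ
  obtain ⟨T, hTZ, hT, hm⟩ := hA (Z \ {v}) fun z hz => (hZ hz.1).resolve_left hz.2
  have hvZ : ∀ z ∈ Z, ¬ G.Adj v z := fun z hz hvz => by
    rcases hZ hz with rfl | h
    exacts [G.irrefl hvz, hv z h hvz]
  refine ⟨{z | z ∈ Z ∧ (z = v ∨ z ∈ T)}, fun z hz => hz.1, ?_, fun Q hQ => ?_⟩
  · rintro a ⟨ha, rfl | haT⟩ b ⟨hb, rfl | hbT⟩ hab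
    exacts [G.irrefl hab, hvZ b hb hab, hvZ a ha hab.symm, hT a haT b hbT hab]
  · by_cases hvQ : v ∈ Q
    · exact ⟨v, ⟨hQ.subset hvQ, .inl rfl⟩, hvQ⟩
    · obtain ⟨a, ha, haQ⟩ := hm Q ⟨fun q hq => ⟨hQ.subset hq, fun e => hvQ (e ▸ hq)⟩, hQ.nonempty,
        hQ.isClique, fun z hz => hQ.mem z hz.1⟩
      exact ⟨a, ⟨hQ.subset haQ, .inr ha⟩, haQ⟩

theorem hasPerfectTransversal [Finite V] (hP : ¬ ContainsInduced P2UnionP4 G)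
    (hb : ¬ ContainsInduced BullGraph G) (hF : ¬ ContainsInduced GrotzschGraph G) (Y : Set V) :
    HasPerfectTransversal G Y := by
  refine hasPerfectTransversal_of_isPrimeOn (fun Y hY => ?_) Y
  by_cases htri : ∃ v ∈ Y, ∃ u ∈ Y, ∃ w ∈ Y, G.Adj v u ∧ G.Adj v w ∧ G.Adj u w
  · obtain ⟨v, hv, u, hu, w, hw, hvu, hvw, huw⟩ := htri
    refine ⟨insert v {y | y ∈ Y ∧ y ≠ v ∧ ¬ G.Adj v y}, Set.insert_subset hv fun y hy => hy.1,
      ((noBull_of_not_containsInduced hb).isStronglyPerfect_of_triangle hP hY hv hu hw hvu hvw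
        huw).insert_of_anticomplete fun y hy => hy.2.2, fun Q hQ => ?_⟩
    by_contra! hcon
    refine hcon v (.inl rfl) (hQ.mem v hv fun q hq hne => ?_)
    by_contra hvq
    exact hcon q (.inr ⟨hQ.subset hq, hne.symm, hvq⟩) hq
  · exact hasPerfectTransversal_of_coloring (colorable_three_of_triangleFree
      (fun x y z hxy hxz hyz => htri ⟨x, x.2, y, y.2, z, z.2, hxy, hxz, hyz⟩)
      (fun h => hP h.of_induce) fun h => hF h.of_induce)

end BullFree

theorem statement_12 {V : Type*} [Fintype V] (G : SimpleGraph V)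
    (hP : ¬ ContainsInduced P2UnionP4 G)
    (hbull : ¬ ContainsInduced BullGraph G)
    (hF1 : ¬ ContainsInduced GrotzschGraph G) :
    G.chromaticNumber ≤ ((G.cliqueNum * (G.cliqueNum + 1) / 2 : ℕ) : ℕ∞) := by
  exact chromaticNumber_le_of_hasPerfectTransversal (hasPerfectTransversal hP hbull hF1)
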